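/- arXiv:2401.04170 — 2 statements merged into one kernel-verified Lean document; each statement's English description precedes it below -/
import Mathlib

section
/- Fix 0 < M ≤ 1/8 and an integer ℓ ≥ 2, and let α : D → ℝ be a smooth solution of the fixed-angular-mode Teukolsky equation T_{+2,ℓ}. Assume the s = +2 scattering data and a priori bounds hold with constants 𝒜, ℬ, 𝒞, ε, C₀, C₁. Then for every fixed u ≤ −1, lim_{v→∞} r(u,v)⁴·α(u,v) = (2M·(−1)^{ℓ+1}/((ℓ−1)(ℓ+2)))·𝒜. In particular, if M·𝒜 ≠ 0 then sup_{v≥1} r(u,v)⁵·|α(u,v)| = ∞ for every u ≤ −1, i.e. the peeling rate Ψ₀ = O(r⁻⁵) fails along every outgoing null line towards future null infinity. -/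
noncomputable section
open Real Set Filter

/-- The domain `D = {(u,v) : u ≤ -1, v ≥ 1}`. -/
def D : Set (ℝ × ℝ) := {p | p.1 ≤ -1 ∧ 1 ≤ p.2}

/-- `Ω² = 1 - 2M/r`. -/
def Om2 (M : ℝ) (r : ℝ → ℝ → ℝ) (u v : ℝ) : ℝ := 1 - 2 * M / r u v

/-- `r` is the Schwarzschild area radius in double null coordinates on `D`:
smooth, `> 2M`, satisfying `r + 2M log(r/(2M)-1) = v - u` and
`∂_v r = 1 - 2M/r = -∂_u r`. -/
structure IsSchwR (M : ℝ) (r : ℝ → ℝ → ℝ) : Prop where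
  smooth : ContDiffOn ℝ (⊤ : ℕ∞) (fun p : ℝ × ℝ => r p.1 p.2) D
  gt2M : ∀ u v : ℝ, (u, v) ∈ D → 2 * M < r u v
  eqn : ∀ u v : ℝ, (u, v) ∈ D →
    r u v + 2 * M * Real.log (r u v / (2 * M) - 1) = v - u
  dv : ∀ u v : ℝ, (u, v) ∈ D →
    deriv (fun v' => r u v') v = 1 - 2 * M / r u v
  du : ∀ u v : ℝ, (u, v) ∈ D →
    deriv (fun u' => r u' v) u = -(1 - 2 * M / r u v)

/-- The base quantity `r^{|s|+s+1}·α`. -/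
def baseF (r α : ℝ → ℝ → ℝ) (s : ℤ) : ℝ → ℝ → ℝ :=
  fun u v => (r u v) ^ (|s| + s + 1) * α u v

/-- The commuted quantities `A^{[s],N} = (Ω^{-2} r² ∂_v)^N f`. -/
def AN (M : ℝ) (r f : ℝ → ℝ → ℝ) : ℕ → ℝ → ℝ → ℝ
  | 0 => f
  | N + 1 => fun u v => (r u v) ^ 2 / Om2 M r u v * deriv (fun v' => AN M r f N u v') v

/-- The fixed-angular-mode Teukolsky equation `T_{s,ℓ}` on `D`:
`∂_u(r^{-2s} Ω^{2s} ∂_v(r^{|s|+s+1} α)) = -(Ω^{2s+2}/r^{2s+2})(ℓ-s)(ℓ+s+1) r^{|s|+s+1} α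
  - (2M Ω^{2s+2}/r^{2s+3})(1+s)(1+2s) r^{|s|+s+1} α`. -/
def TeukEq (M : ℝ) (r α : ℝ → ℝ → ℝ) (s : ℤ) (ℓ : ℕ) : Prop :=
  ∀ u v : ℝ, (u, v) ∈ D →
    deriv (fun u' => (r u' v) ^ (-(2 * s)) * (Om2 M r u' v) ^ s *
        deriv (fun v' => baseF r α s u' v') v) u
      = -((Om2 M r u v) ^ (s + 1) / (r u v) ^ (2 * s + 2)) * ((ℓ : ℝ) - (s : ℝ)) *
          ((ℓ : ℝ) + (s : ℝ) + 1) * baseF r α s u v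
        - (2 * M * (Om2 M r u v) ^ (s + 1) / (r u v) ^ (2 * s + 3)) * (1 + (s : ℝ)) *
          (1 + 2 * (s : ℝ)) * baseF r α s u v

/-- The `s = +2` scattering data and a priori bounds, with constants `A, B, C, ε, C₀, C₁`:
the Post-Newtonian expansion of `α = Ψ₀`-mode along the cone `C = {v = 1}`, no incoming
radiation from past null infinity, and the a priori bounds on the commuted quantities. -/
structure PlusData (M : ℝ) (r α : ℝ → ℝ → ℝ) (ℓ : ℕ) (A B C ε C₀ C₁ : ℝ) : Prop where
  hε : 0 < ε ∧ ε < 1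
  hC₀ : 0 < C₀
  hC₁ : 0 < C₁
  data : ∀ u : ℝ, u ≤ -1 →
    |α u 1 - A * (r u 1) ^ (-3 : ℤ)
        + (1 / 6) * ((Nat.factorial (ℓ + 2) : ℝ) / (Nat.factorial (ℓ - 2) : ℝ)) * B *
          (r u 1) ^ (-4 : ℤ) * Real.log (r u 1)
        - C * (r u 1) ^ (-4 : ℤ)| ≤ C₀ * (r u 1) ^ (-4 - ε)
  noincoming : ∀ n : ℕ, 1 ≤ n → ∀ v : ℝ, 1 ≤ v →
    Tendsto (fun u => iteratedDeriv n (fun v' => r u v' * α u v') v) atBot (nhds 0)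
  apriori : ∀ N : ℕ, N ≤ ℓ - 2 → ∀ u v : ℝ, (u, v) ∈ D →
    |AN M r (baseF r α 2) N u v| ≤
      C₁ * (r u v) ^ N * (u ^ 2 + M * r u v * (Real.log (2 + r u v)) ^ 2)

/-- `f = O((v-u)^p)` uniformly over `u ≤ -1` and `v ∈ S` with `v ≥ 1`. -/
def DecayBound (S : Set ℝ) (f : ℝ → ℝ → ℝ) (p : ℝ) : Prop :=
  ∃ C : ℝ, 0 ≤ C ∧ ∀ u v : ℝ, u ≤ -1 → 1 ≤ v → v ∈ S → |f u v| ≤ C * (v - u) ^ p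

namespace DecayBound

variable {S T : Set ℝ} {f g : ℝ → ℝ → ℝ} {p q : ℝ}

lemma congr (hf : DecayBound S f p)
    (h : ∀ u v : ℝ, u ≤ -1 → 1 ≤ v → v ∈ S → g u v = f u v) : DecayBound S g p := by
  obtain ⟨C, hC, hb⟩ := hf
  exact ⟨C, hC, fun u v hu hv hS => by rw [h u v hu hv hS]; exact hb u v hu hv hS⟩

lemma subset (hf : DecayBound S f p) (h : T ⊆ S) : DecayBound T f p := by
  obtain ⟨C, hC, hb⟩ := hf
  exact ⟨C, hC, fun u v hu hv hS => hb u v hu hv (h hS)⟩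

lemma mono (hf : DecayBound S f p) (hpq : p ≤ q) : DecayBound S f q := by
  obtain ⟨C, hC, hb⟩ := hf
  refine ⟨C, hC, fun u v hu hv hS => (hb u v hu hv hS).trans ?_⟩
  have : (v - u) ^ p ≤ (v - u) ^ q := Real.rpow_le_rpow_of_exponent_le (by linarith) hpq
  gcongr

lemma add (hf : DecayBound S f p) (hg : DecayBound S g p) :
    DecayBound S (fun u v => f u v + g u v) p := by
  obtain ⟨C, hC, hb⟩ := hf
  obtain ⟨C', hC', hb'⟩ := hg
  refine ⟨C + C', by positivity, fun u v hu hv hS => (abs_add_le _ _).trans ?_⟩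
  rw [add_mul]
  exact add_le_add (hb u v hu hv hS) (hb' u v hu hv hS)

lemma mul (hf : DecayBound S f p) (hg : DecayBound S g q) :
    DecayBound S (fun u v => f u v * g u v) (p + q) := by
  obtain ⟨C, hC, hb⟩ := hf
  obtain ⟨C', hC', hb'⟩ := hg
  refine ⟨C * C', by positivity, fun u v hu hv hS => ?_⟩
  rw [abs_mul, Real.rpow_add (by linarith)]
  calc _ ≤ (C * (v - u) ^ p) * (C' * (v - u) ^ q) := by
        exact mul_le_mul (hb u v hu hv hS) (hb' u v hu hv hS) (abs_nonneg _)
          ((abs_nonneg _).trans (hb u v hu hv hS))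
    _ = _ := by ring

lemma const (S : Set ℝ) (c : ℝ) : DecayBound S (fun _ _ => c) 0 :=
  ⟨|c|, abs_nonneg c, fun u v _ _ _ => by simp⟩

lemma const_mul (c : ℝ) (hf : DecayBound S f p) : DecayBound S (fun u v => c * f u v) p := by
  have h := (const S c).mul hf
  rwa [zero_add] at h

lemma neg (hf : DecayBound S f p) : DecayBound S (fun u v => -f u v) p :=
  (hf.const_mul (-1)).congr fun _ _ _ _ _ => by ring

lemma sub (hf : DecayBound S f p) (hg : DecayBound S g p) :
    DecayBound S (fun u v => f u v - g u v) p :=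
  (hf.add hg.neg).congr fun _ _ _ _ _ => by ring

lemma rpow (S : Set ℝ) (p : ℝ) : DecayBound S (fun u v => (v - u) ^ p) p :=
  ⟨1, zero_le_one, fun u v hu hv _ => by
    rw [one_mul, abs_of_nonneg (Real.rpow_nonneg (by linarith) _)]⟩

lemma pow (hf : DecayBound S f p) (n : ℕ) : DecayBound S (fun u v => f u v ^ n) (n * p) := by
  induction n with
  | zero => simpa using const S 1
  | succ n ih =>
    have h := (ih.mul hf).congr (g := fun u v => f u v ^ (n + 1)) fun _ _ _ _ _ => pow_succ _ _
    refine h.mono (le_of_eq ?_)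
    push_cast
    ring

lemma of_pos (h : ∀ u v : ℝ, u ≤ -1 → 1 ≤ v → v ∈ S → |f u v| ≤ |g u v|)
    (hg : DecayBound S g p) : DecayBound S f p := by
  obtain ⟨C, hC, hb⟩ := hg
  exact ⟨C, hC, fun u v hu hv hS => (h u v hu hv hS).trans (hb u v hu hv hS)⟩

lemma tendsto_atBot (hf : DecayBound S f p) (hp : p < 0) {v : ℝ} (hv : 1 ≤ v) (hS : v ∈ S) :
    Tendsto (fun u => f u v) atBot (nhds 0) := by
  obtain ⟨C, hC, hb⟩ := hf
  have h1 : Tendsto (fun u : ℝ => v - u) atBot atTop := by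
    simpa [sub_eq_add_neg] using
      tendsto_atTop_add_const_left atBot v (tendsto_neg_atBot_atTop (G := ℝ))
  have h2 : Tendsto (fun u : ℝ => C * (v - u) ^ p) atBot (nhds 0) := by
    have := (tendsto_rpow_neg_atTop (y := -p) (by linarith)).comp h1
    simpa using this.const_mul C
  refine squeeze_zero_norm' ?_ h2
  filter_upwards [eventually_le_atBot (-1 : ℝ)] with u hu
  simpa using hb u v hu hv hS

lemma tendsto_atTop (hf : DecayBound S f p) (hp : p < 0) {u : ℝ} (hu : u ≤ -1)
    (hS : S ∈ atTop) : Tendsto (fun v => f u v) atTop (nhds 0) := by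
  obtain ⟨C, hC, hb⟩ := hf
  have h1 : Tendsto (fun v : ℝ => v - u) atTop atTop := by
    simpa [sub_eq_add_neg] using tendsto_atTop_add_const_right atTop (-u) tendsto_id
  have h2 : Tendsto (fun v : ℝ => C * (v - u) ^ p) atTop (nhds 0) := by
    have := (tendsto_rpow_neg_atTop (y := -p) (by linarith)).comp h1
    simpa using this.const_mul C
  refine squeeze_zero_norm' ?_ h2
  filter_upwards [eventually_ge_atTop (1 : ℝ), hS] with v hv hv'
  simpa using hb u v hu hv hv'

/-- Integration of a decay estimate in `u` from past infinity. -/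
lemma of_deriv_u {g' : ℝ → ℝ → ℝ} (hp : 0 < p)
    (hcont : ∀ v, 1 ≤ v → v ∈ S → ContinuousOn (fun u => g u v) (Iic (-1)))
    (hderiv : ∀ u v, u < -1 → 1 ≤ v → v ∈ S → HasDerivAt (fun u => g u v) (g' u v) u)
    (hlim : ∀ v, 1 ≤ v → v ∈ S → Tendsto (fun u => g u v) atBot (nhds 0))
    (hg' : DecayBound S g' (-p - 1)) : DecayBound S g (-p) := by
  obtain ⟨C, hC, hb⟩ := hg'
  refine ⟨C / p, by positivity, fun u v hu hv hS => ?_⟩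
  have hρ : ∀ u' ≤ (-1 : ℝ), 0 < v - u' := fun u' h => by linarith
  have hW : ∀ u' ≤ (-1 : ℝ), HasDerivAt (fun u => C / p * (v - u) ^ (-p))
      (C * (v - u') ^ (-p - 1)) u' := fun u' h => by
    have h1 : HasDerivAt (fun u : ℝ => v - u) (-1) u' := by
      simpa using (hasDerivAt_id u').const_sub v
    refine ((h1.rpow_const (p := -p) (Or.inl (hρ u' h).ne')).const_mul (C / p)).congr_deriv ?_
    field_simp
  have hWlim : Tendsto (fun u => C / p * (v - u) ^ (-p)) atBot (nhds 0) := by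
    simpa using ((rpow S (-p)).const_mul (C / p)).tendsto_atBot (by linarith) hv hS
  have key : ∀ s : ℝ, |s| = 1 → 0 ≤ C / p * (v - u) ^ (-p) + s * g u v := by
    intro s hs
    have hmono : MonotoneOn (fun u => C / p * (v - u) ^ (-p) + s * g u v) (Iic (-1)) := by
      have hd : ∀ x ∈ interior (Iic (-1 : ℝ)),
          HasDerivAt (fun u => C / p * (v - u) ^ (-p) + s * g u v)
            (C * (v - x) ^ (-p - 1) + s * g' x v) x := fun x hx => by
        rw [interior_Iic] at hx
        exact (hW x hx.le).add ((hderiv x v hx hv hS).const_mul s)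
      refine monotoneOn_of_deriv_nonneg (convex_Iic _) ?_
        (fun x hx => (hd x hx).differentiableAt.differentiableWithinAt) ?_
      · exact ContinuousOn.add (fun x hx => (hW x hx).continuousAt.continuousWithinAt)
          (continuousOn_const.mul (hcont v hv hS))
      · intro x hx
        rw [(hd x hx).deriv]
        rw [interior_Iic] at hx
        have h1 := hb x v (le_of_lt hx) hv hS
        have h2 : |s * g' x v| ≤ C * (v - x) ^ (-p - 1) := by rwa [abs_mul, hs, one_mul]
        linarith [neg_abs_le (s * g' x v)]
    have hl : Tendsto (fun u => C / p * (v - u) ^ (-p) + s * g u v) atBot (nhds 0) := by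
      simpa using hWlim.add ((hlim v hv hS).const_mul s)
    refine le_of_tendsto hl ?_
    filter_upwards [eventually_le_atBot u] with x hx
    exact hmono (hx.trans hu) hu hx
  rw [abs_le]
  constructor
  · have := key 1 (by simp); linarith
  · have := key (-1) (by simp); linarith

/-- Integration of a growth estimate in `v` from `v = 2`. -/
lemma of_deriv_v {g' : ℝ → ℝ → ℝ} (hp : 0 < p)
    (hderiv : ∀ u v, u ≤ -1 → 2 ≤ v → HasDerivAt (fun v => g u v) (g' u v) v)
    (hg' : DecayBound (Ici 2) g' (p - 1)) (h2 : DecayBound {2} g p) :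
    DecayBound (Ici 2) g p := by
  obtain ⟨C, hC, hb⟩ := hg'
  obtain ⟨C', hC', hb'⟩ := h2
  refine ⟨C / p + C', by positivity, fun u v hu _ hS => ?_⟩
  have hS : (2 : ℝ) ≤ v := hS
  have hW : ∀ x : ℝ, 2 ≤ x → HasDerivAt (fun v => (C / p) * (v - u) ^ p)
      (C * (x - u) ^ (p - 1)) x := fun x h => by
    have h1 : HasDerivAt (fun v : ℝ => v - u) 1 x := (hasDerivAt_id x).sub_const u
    refine ((h1.rpow_const (p := p) (Or.inl (by linarith))).const_mul (C / p)).congr_deriv ?_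
    field_simp
  have key : ∀ s : ℝ, |s| = 1 →
      (C / p) * (2 - u) ^ p + s * g u 2 ≤ (C / p) * (v - u) ^ p + s * g u v := by
    intro s hs
    have hd : ∀ x : ℝ, 2 ≤ x → HasDerivAt (fun v => (C / p) * (v - u) ^ p + s * g u v)
        (C * (x - u) ^ (p - 1) + s * g' u x) x := fun x hx =>
      (hW x hx).add ((hderiv u x hu hx).const_mul s)
    have hmono : MonotoneOn (fun v => (C / p) * (v - u) ^ p + s * g u v) (Ici 2) := by
      refine monotoneOn_of_deriv_nonneg (convex_Ici _)
        (fun x hx => (hd x hx).continuousAt.continuousWithinAt)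
        (fun x hx => (hd x (interior_subset hx)).differentiableAt.differentiableWithinAt) ?_
      intro x hx
      have hx : (2 : ℝ) ≤ x := interior_subset hx
      rw [(hd x hx).deriv]
      have h1 := hb u x hu (by linarith) hx
      have h2 : |s * g' u x| ≤ C * (x - u) ^ (p - 1) := by rwa [abs_mul, hs, one_mul]
      linarith [neg_abs_le (s * g' u x)]
    exact hmono (mem_Ici.2 le_rfl) hS hS
  have h0 : 0 ≤ (C / p) * (2 - u) ^ p := by
    have : 0 ≤ (2 - u) ^ p := Real.rpow_nonneg (by linarith) _
    positivity
  have h3 : |g u 2| ≤ C' * (v - u) ^ p := by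
    refine (hb' u 2 hu (by norm_num) rfl).trans ?_
    have : (2 - u) ^ p ≤ (v - u) ^ p :=
      Real.rpow_le_rpow (by linarith) (by linarith) hp.le
    gcongr
  have h4 := abs_le.1 h3
  rw [abs_le, add_mul]
  constructor
  · have := key 1 (by simp); linarith
  · have := key (-1) (by simp); linarith

end DecayBound

/-- If `g' ~ K vⁿ` then `g ~ K vⁿ⁺¹ / (n+1)`. -/
lemma tendsto_div_pow_of_deriv {g g' : ℝ → ℝ} {a K : ℝ} (n : ℕ)
    (hd : ∀ v, a ≤ v → HasDerivAt g (g' v) v)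
    (hlim : Tendsto (fun v => g' v / v ^ n) atTop (nhds K)) :
    Tendsto (fun v => g v / v ^ (n + 1)) atTop (nhds (K / (n + 1))) := by
  have hn : (0 : ℝ) < n + 1 := by positivity
  rw [Metric.tendsto_atTop]
  intro η hη
  obtain ⟨b, hb⟩ := (Metric.tendsto_atTop.1 hlim) (η / 2) (by positivity)
  obtain ⟨c, hca, hcb, hc1⟩ : ∃ c, a ≤ c ∧ b ≤ c ∧ 1 ≤ c :=
    ⟨max a (max b 1), le_max_left _ _, (le_max_left _ _).trans (le_max_right _ _),
      (le_max_right _ _).trans (le_max_right _ _)⟩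
  set E : ℝ := |g c - K / (n + 1) * c ^ (n + 1)| with hE
  have hmain : ∀ v, c ≤ v →
      |g v - K / (n + 1) * v ^ (n + 1)| ≤ E + η / 2 / (n + 1) * v ^ (n + 1) := by
    intro v hv
    have hpow : ∀ (k x : ℝ), HasDerivAt (fun v : ℝ => k / (n + 1) * v ^ (n + 1)) (k * x ^ n) x := by
      intro k x
      refine ((hasDerivAt_pow (n + 1) x).const_mul (k / (n + 1))).congr_deriv ?_
      push_cast
      field_simp
    have key : ∀ s : ℝ, |s| = 1 →
        η / 2 / (n + 1) * c ^ (n + 1) + s * (g c - K / (n + 1) * c ^ (n + 1)) ≤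
        η / 2 / (n + 1) * v ^ (n + 1) + s * (g v - K / (n + 1) * v ^ (n + 1)) := by
      intro s hs
      have hd' : ∀ x, c ≤ x → HasDerivAt
          (fun v => η / 2 / (n + 1) * v ^ (n + 1) + s * (g v - K / (n + 1) * v ^ (n + 1)))
          (η / 2 * x ^ n + s * (g' x - K * x ^ n)) x := fun x hx =>
        (hpow _ x).add (((hd x (hca.trans hx)).sub (hpow _ x)).const_mul s)
      have hmono : MonotoneOn
          (fun v => η / 2 / (n + 1) * v ^ (n + 1) + s * (g v - K / (n + 1) * v ^ (n + 1)))
          (Ici c) := by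
        refine monotoneOn_of_deriv_nonneg (convex_Ici _)
          (fun x hx => (hd' x hx).continuousAt.continuousWithinAt)
          (fun x hx => (hd' x (interior_subset hx)).differentiableAt.differentiableWithinAt) ?_
        intro x hx
        have hx : c ≤ x := interior_subset hx
        rw [(hd' x hx).deriv]
        have h1 := hb x (hcb.trans hx)
        rw [Real.dist_eq] at h1
        have hxn : 0 < x ^ n := pow_pos (by linarith) n
        have h2 : |s * (g' x - K * x ^ n)| ≤ η / 2 * x ^ n := by
          rw [abs_mul, hs, one_mul]
          have : g' x - K * x ^ n = (g' x / x ^ n - K) * x ^ n := by field_simp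
          rw [this, abs_mul, abs_of_pos hxn]
          gcongr
        linarith [neg_abs_le (s * (g' x - K * x ^ n))]
      exact hmono (mem_Ici.2 le_rfl) hv hv
    have h0 : 0 ≤ η / 2 / (n + 1) * c ^ (n + 1) := by positivity
    have h4 := abs_le.1 hE.symm.le
    rw [abs_le]
    constructor
    · have := key 1 (by simp); linarith
    · have := key (-1) (by simp); linarith
  have hE0 : 0 ≤ E := abs_nonneg _
  refine ⟨max c (2 * E / η + 1), fun v hv => ?_⟩
  have hvc : c ≤ v := (le_max_left _ _).trans hv
  have hvE : 2 * E / η + 1 ≤ v := (le_max_right _ _).trans hv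
  have hv1 : 1 ≤ v := hc1.trans hvc
  have hvn : v ≤ v ^ (n + 1) := le_self_pow₀ hv1 (by omega)
  have hvn0 : 0 < v ^ (n + 1) := by positivity
  rw [Real.dist_eq]
  have h1 : g v / v ^ (n + 1) - K / (n + 1)
      = (g v - K / (n + 1) * v ^ (n + 1)) / v ^ (n + 1) := by field_simp
  rw [h1, abs_div, abs_of_pos hvn0, div_lt_iff₀ hvn0]
  have h2 := hmain v hvc
  have h3 : E < η / 2 * v ^ (n + 1) := by
    have : 2 * E / η < v ^ (n + 1) := by linarith
    rw [div_lt_iff₀ hη] at this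
    linarith
  have h4 : η / 2 / (n + 1) * v ^ (n + 1) ≤ η / 2 * v ^ (n + 1) := by
    exact mul_le_mul_of_nonneg_right
      (div_le_self (by positivity) (by linarith [(Nat.cast_nonneg n : (0 : ℝ) ≤ n)])) hvn0.le
  linarith

/-- The Euler beta integral at positive integers. -/
lemma integral_pow_mul_one_sub_pow (a b : ℕ) :
    ∫ x in (0 : ℝ)..1, x ^ a * (1 - x) ^ b
      = (a.factorial * b.factorial : ℝ) / (a + b + 1).factorial := by
  induction a generalizing b with
  | zero =>
    have : ∫ x in (0 : ℝ)..1, (1 - x) ^ b = ∫ x in (0 : ℝ)..1, x ^ b := by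
      simpa using intervalIntegral.integral_comp_sub_left (a := (0 : ℝ)) (b := 1)
        (fun x : ℝ => x ^ b) 1
    simp only [pow_zero, one_mul, this, integral_pow, Nat.factorial_zero, Nat.cast_one, zero_add,
      Nat.factorial_succ]
    push_cast
    have := Nat.factorial_pos b
    field_simp
    simp
  | succ a ih =>
    have h1 : ∀ x ∈ uIcc (0 : ℝ) 1, HasDerivAt (fun x : ℝ => x ^ (a + 1)) ((a + 1) * x ^ a) x :=
      fun x _ => by simpa using hasDerivAt_pow (a + 1) x
    have h2 : ∀ x ∈ uIcc (0 : ℝ) 1, HasDerivAt (fun x : ℝ => -(1 - x) ^ (b + 1) / (b + 1))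
        ((1 - x) ^ b) x := fun x _ => by
      have h3 : HasDerivAt (fun x : ℝ => 1 - x) (-1) x := by
        simpa using (hasDerivAt_id x).const_sub 1
      refine (((h3.pow (b + 1)).neg).div_const (b + 1 : ℝ)).congr_deriv ?_
      push_cast
      have : (b + 1 : ℝ) ≠ 0 := by positivity
      field_simp
    rw [intervalIntegral.integral_mul_deriv_eq_deriv_mul h1 h2
      (Continuous.intervalIntegrable (by fun_prop) _ _)
      (Continuous.intervalIntegrable (by fun_prop) _ _)]
    have h4 : (fun x : ℝ => (a + 1) * x ^ a * (-(1 - x) ^ (b + 1) / (b + 1)))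
        = fun x : ℝ => -((a + 1) / (b + 1)) * (x ^ a * (1 - x) ^ (b + 1)) := by
      funext x; ring
    rw [h4, intervalIntegral.integral_const_mul, ih (b + 1)]
    have h5 : a + (b + 1) + 1 = a + 1 + b + 1 := by ring
    rw [h5, Nat.factorial_succ a, Nat.factorial_succ b]
    have h6 : ((a + 1 + b + 1).factorial : ℝ) ≠ 0 := by positivity
    have h7 : (b + 1 : ℝ) ≠ 0 := by positivity
    push_cast
    simp
    field_simp

namespace IsSchwR

variable {M : ℝ} {r : ℝ → ℝ → ℝ} (hr : IsSchwR M r) (hM : 0 < M) (hM' : M ≤ 1 / 8)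

include hr hM hM'

lemma one_le {u v : ℝ} (hu : u ≤ -1) (hv : 1 ≤ v) : 1 ≤ r u v := by
  by_contra! hlt
  have hgt := hr.gt2M u v ⟨hu, hv⟩
  have heq := hr.eqn u v ⟨hu, hv⟩
  have h1 : 0 < r u v / (2 * M) - 1 := by
    rw [sub_pos, lt_div_iff₀ (by positivity)]; linarith
  have h2 := Real.log_le_sub_one_of_pos h1
  have h3 : 2 * M * (r u v / (2 * M) - 1 - 1) = r u v - 4 * M := by field_simp; ring
  nlinarith

lemma le_sub {u v : ℝ} (hu : u ≤ -1) (hv : 1 ≤ v) : r u v ≤ v - u := by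
  have h1 := hr.one_le hM hM' hu hv
  have heq := hr.eqn u v ⟨hu, hv⟩
  have h2 : 1 ≤ r u v / (2 * M) - 1 := by
    rw [le_sub_iff_add_le, le_div_iff₀ (by positivity)]; linarith
  have h3 := Real.log_nonneg h2
  nlinarith

lemma sub_le {u v : ℝ} (hu : u ≤ -1) (hv : 1 ≤ v) : v - u ≤ 2 * r u v := by
  have h1 := hr.one_le hM hM' hu hv
  have heq := hr.eqn u v ⟨hu, hv⟩
  have h2 : 0 < r u v / (2 * M) - 1 := by
    rw [sub_pos, lt_div_iff₀ (by positivity)]; linarith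
  have h3 := Real.log_le_sub_one_of_pos h2
  have h4 : 2 * M * (r u v / (2 * M) - 1 - 1) = r u v - 4 * M := by field_simp; ring
  nlinarith

lemma sub_sub_le {u v : ℝ} (hu : u ≤ -1) (hv : 1 ≤ v) :
    v - u - r u v ≤ 4 * (v - u) ^ (1 / 2 : ℝ) := by
  have h1 := hr.one_le hM hM' hu hv
  have hle := hr.le_sub hM hM' hu hv
  have heq := hr.eqn u v ⟨hu, hv⟩
  have h2 : 0 < r u v / (2 * M) - 1 := by
    rw [sub_pos, lt_div_iff₀ (by positivity)]; linarith
  have h3 := Real.log_le_sub_one_of_pos (Real.sqrt_pos.2 h2)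
  rw [Real.log_sqrt h2.le] at h3
  have h4 : M * √(r u v / (2 * M) - 1) ≤ √(v - u) := by
    apply Real.le_sqrt_of_sq_le
    rw [mul_pow, Real.sq_sqrt h2.le]
    have : M ^ 2 * (r u v / (2 * M) - 1) = M * r u v / 2 - M ^ 2 := by field_simp
    rw [this]
    nlinarith
  rw [← Real.sqrt_eq_rpow]
  nlinarith

lemma Om2_mem {u v : ℝ} (hu : u ≤ -1) (hv : 1 ≤ v) : 3 / 4 ≤ Om2 M r u v ∧ Om2 M r u v ≤ 1 := by
  have h1 := hr.one_le hM hM' hu hv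
  have h2 : 2 * M / r u v ≤ 1 / 4 := by
    rw [div_le_iff₀ (by linarith)]; linarith
  have h3 : 0 ≤ 2 * M / r u v := by positivity
  unfold Om2
  constructor <;> linarith

lemma hasDerivAt_v {u v : ℝ} (hu : u ≤ -1) (hv : 1 ≤ v) :
    HasDerivAt (fun v => r u v) (Om2 M r u v) v := by
  have h := hr.dv u v ⟨hu, hv⟩
  have h2 := (hr.Om2_mem hM hM' hu hv).1
  unfold Om2 at h2 ⊢
  rw [← h] at h2 ⊢
  exact (differentiableAt_of_deriv_ne_zero (by linarith)).hasDerivAt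

lemma hasDerivAt_u {u v : ℝ} (hu : u ≤ -1) (hv : 1 ≤ v) :
    HasDerivAt (fun u => r u v) (-Om2 M r u v) u := by
  have h := hr.du u v ⟨hu, hv⟩
  have h2 := (hr.Om2_mem hM hM' hu hv).1
  unfold Om2 at h2 ⊢
  rw [← h]
  exact (differentiableAt_of_deriv_ne_zero (by linarith)).hasDerivAt

end IsSchwR

/-- The weight `w = Ω² / r²`, so that `A^{[s],N+1} = w⁻¹ ∂_v A^{[s],N}`. -/
def weight (M : ℝ) (r : ℝ → ℝ → ℝ) (u v : ℝ) : ℝ := Om2 M r u v / r u v ^ 2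

/-- The derivative of `weight` with respect to `1/r`. -/
def weightDeriv (M : ℝ) (r : ℝ → ℝ → ℝ) (u v : ℝ) : ℝ := 2 * (r u v)⁻¹ - 6 * M * (r u v)⁻¹ ^ 2

namespace IsSchwR

variable {M : ℝ} {r : ℝ → ℝ → ℝ} (hr : IsSchwR M r) (hM : 0 < M) (hM' : M ≤ 1 / 8)

lemma weight_eq (M : ℝ) (r : ℝ → ℝ → ℝ) (u v : ℝ) :
    weight M r u v = (r u v)⁻¹ ^ 2 - 2 * M * (r u v)⁻¹ ^ 3 := by
  unfold weight Om2
  ring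

include hr hM hM'

lemma weight_pos {u v : ℝ} (hu : u ≤ -1) (hv : 1 ≤ v) : 0 < weight M r u v := by
  have h1 := hr.one_le hM hM' hu hv
  have h2 := (hr.Om2_mem hM hM' hu hv).1
  unfold weight
  positivity

lemma hasDerivAt_inv_v {u v : ℝ} (hu : u ≤ -1) (hv : 1 ≤ v) :
    HasDerivAt (fun v => (r u v)⁻¹) (-weight M r u v) v := by
  have h1 := hr.one_le hM hM' hu hv
  refine ((hr.hasDerivAt_v hM hM' hu hv).fun_inv (by linarith)).congr_deriv ?_
  unfold weight
  ring

lemma hasDerivAt_inv_u {u v : ℝ} (hu : u ≤ -1) (hv : 1 ≤ v) :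
    HasDerivAt (fun u => (r u v)⁻¹) (weight M r u v) u := by
  have h1 := hr.one_le hM hM' hu hv
  refine ((hr.hasDerivAt_u hM hM' hu hv).fun_inv (by linarith)).congr_deriv ?_
  unfold weight
  ring

lemma hasDerivAt_weight_u {u v : ℝ} (hu : u ≤ -1) (hv : 1 ≤ v) :
    HasDerivAt (fun u => weight M r u v) (weight M r u v * weightDeriv M r u v) u := by
  have h := hr.hasDerivAt_inv_u hM hM' hu hv
  simp_rw [weight_eq]
  refine ((h.fun_pow 2).fun_sub ((h.fun_pow 3).const_mul (2 * M))).congr_deriv ?_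
  rw [weight_eq]
  unfold weightDeriv
  push_cast
  ring

lemma hasDerivAt_weightDeriv_v {u v : ℝ} (hu : u ≤ -1) (hv : 1 ≤ v) :
    HasDerivAt (fun v => weightDeriv M r u v)
      (-(weight M r u v * (2 - 12 * M * (r u v)⁻¹))) v := by
  have h := hr.hasDerivAt_inv_v hM hM' hu hv
  unfold weightDeriv
  refine ((h.const_mul 2).fun_sub ((h.fun_pow 2).const_mul (6 * M))).congr_deriv ?_
  push_cast
  ring

lemma decay_inv (S : Set ℝ) : DecayBound S (fun u v => (r u v)⁻¹) (-1) := by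
  refine ⟨2, by norm_num, fun u v hu hv _ => ?_⟩
  have h1 := hr.one_le hM hM' hu hv
  have h2 := hr.sub_le hM hM' hu hv
  rw [abs_of_nonneg (by positivity), Real.rpow_neg_one, ← div_eq_mul_inv]
  beta_reduce
  rw [inv_eq_one_div, div_le_div_iff₀ (by linarith) (by linarith)]
  linarith

lemma decay_r (S : Set ℝ) : DecayBound S (fun u v => r u v) 1 := by
  refine ⟨1, by norm_num, fun u v hu hv _ => ?_⟩
  have h1 := hr.one_le hM hM' hu hv
  have h2 := hr.le_sub hM hM' hu hv
  rw [abs_of_nonneg (by positivity), Real.rpow_one]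
  linarith

lemma decay_r_sub (S : Set ℝ) : DecayBound S (fun u v => r u v - (v - u)) (1 / 2) := by
  refine ⟨4, by norm_num, fun u v hu hv _ => ?_⟩
  have h1 := hr.le_sub hM hM' hu hv
  have h2 := hr.sub_sub_le hM hM' hu hv
  rw [abs_of_nonpos (by linarith)]
  linarith

lemma decay_inv_sub (S : Set ℝ) :
    DecayBound S (fun u v => (r u v)⁻¹ - (v - u)⁻¹) (-3 / 2) := by
  have h := (((hr.decay_r_sub hM hM' S).mul (hr.decay_inv hM hM' S)).mul
    (DecayBound.rpow S (-1))).neg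
  refine (h.congr (g := fun u v => (r u v)⁻¹ - (v - u)⁻¹) ?_).mono (by norm_num)
  intro u v hu hv _
  have h1 := hr.one_le hM hM' hu hv
  have h2 : 0 < v - u := by linarith
  rw [Real.rpow_neg_one]
  field_simp
  ring

lemma decay_weight (S : Set ℝ) : DecayBound S (fun u v => weight M r u v) (-2) := by
  have h := hr.decay_inv hM hM' S
  have h2 := ((h.pow 2).mono (q := -2) (by norm_num)).sub
    (((h.pow 3).mono (q := -2) (by norm_num)).const_mul (2 * M))
  exact h2.congr fun u v _ _ _ => weight_eq M r u v

lemma decay_weight_inv (S : Set ℝ) : DecayBound S (fun u v => (weight M r u v)⁻¹) 2 := by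
  have h := ((hr.decay_r hM hM' S).pow 2).const_mul 2
  refine (DecayBound.of_pos ?_ h).mono (by norm_num)
  intro u v hu hv _
  have h1 := hr.one_le hM hM' hu hv
  have h2 := (hr.Om2_mem hM hM' hu hv).1
  rw [abs_of_pos (inv_pos.2 (hr.weight_pos hM hM' hu hv)), abs_of_nonneg (by positivity)]
  unfold weight
  rw [inv_div, div_le_iff₀ (by linarith)]
  nlinarith [sq_nonneg (r u v)]

lemma decay_weight_sub (S : Set ℝ) :
    DecayBound S (fun u v => weight M r u v - (v - u) ^ (-2 : ℝ)) (-2 - 1 / 2) := by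
  have h := hr.decay_inv hM hM' S
  have h1 := (hr.decay_inv_sub hM hM' S).mul (h.add (DecayBound.rpow S (-1)))
  have h2 := (h1.mono (q := -2 - 1 / 2) (by norm_num)).sub
    (((h.pow 3).mono (q := -2 - 1 / 2) (by norm_num)).const_mul (2 * M))
  refine h2.congr fun u v hu hv _ => ?_
  have h3 : 0 < v - u := by linarith
  rw [weight_eq, Real.rpow_neg_one, show (-2 : ℝ) = -((2 : ℕ) : ℝ) by norm_num,
    Real.rpow_neg h3.le, Real.rpow_natCast, ← inv_pow]
  generalize (v - u)⁻¹ = y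
  ring

lemma decay_weight_pow (S : Set ℝ) (n : ℕ) :
    DecayBound S (fun u v => weight M r u v ^ n) (-2 * n) :=
  ((hr.decay_weight hM hM' S).pow n).mono (by linarith)

lemma decay_weight_pow_sub (S : Set ℝ) (n : ℕ) :
    DecayBound S (fun u v => weight M r u v ^ n - (v - u) ^ (-2 * n : ℝ)) (-2 * n - 1 / 2) := by
  induction n with
  | zero =>
    refine ((DecayBound.const S 0).mul (DecayBound.rpow S (-1 / 2))).congr ?_ |>.mono (by norm_num)
    intro u v _ _ _
    simp
  | succ n ih =>
    have h := ((hr.decay_weight_pow hM hM' S n).mul (hr.decay_weight_sub hM hM' S)).mono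
      (q := -2 * n - 2 - 1 / 2) (by linarith) |>.add
      ((ih.mul (DecayBound.rpow S (-2))).mono (q := -2 * n - 2 - 1 / 2) (by linarith))
    refine (h.congr (g := fun u v => weight M r u v ^ (n + 1)
      - (v - u) ^ (-2 * ((n + 1 : ℕ) : ℝ))) ?_).mono (by push_cast; linarith)
    intro u v hu hv _
    have h3 : 0 < v - u := by linarith
    have h4 : (-2 * ((n + 1 : ℕ) : ℝ)) = -2 * n + -2 := by push_cast; ring
    rw [h4, Real.rpow_add h3, pow_succ]
    ring

end IsSchwR

/-- Smoothness on the part `{u ≤ -1, v > 1}` of `D`. -/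
def SmoothOffCone (g : ℝ → ℝ → ℝ) : Prop :=
  ContDiffOn ℝ (⊤ : ℕ∞) (fun p : ℝ × ℝ => g p.1 p.2) (Iic (-1) ×ˢ Ioi 1)

namespace SmoothOffCone

variable {g : ℝ → ℝ → ℝ} (hg : SmoothOffCone g)

lemma uniqueDiffOn : UniqueDiffOn ℝ (Iic (-1 : ℝ) ×ˢ Ioi (1 : ℝ)) :=
  (uniqueDiffOn_Iic _).prod (uniqueDiffOn_Ioi _)

include hg

lemma hasDerivAt_fderivWithin {u v : ℝ} (hu : u ≤ -1) (hv : 1 < v) :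
    HasDerivAt (g u)
      (fderivWithin ℝ (fun p : ℝ × ℝ => g p.1 p.2) (Iic (-1) ×ˢ Ioi 1) (u, v) (0, 1)) v := by
  have h1 := ((hg.differentiableOn (by simp)) (u, v) ⟨hu, hv⟩).hasFDerivWithinAt
  have h2 : HasDerivAt (fun v : ℝ => (u, v)) (0, 1) v :=
    (hasDerivAt_const v u).prodMk (hasDerivAt_id v)
  have h3 : MapsTo (fun v : ℝ => (u, v)) (Ioi 1) (Iic (-1) ×ˢ Ioi 1) := fun x hx => ⟨hu, hx⟩
  exact (h1.comp_hasDerivWithinAt v h2.hasDerivWithinAt h3).hasDerivAt (Ioi_mem_nhds hv)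

lemma hasDerivAt_v {u v : ℝ} (hu : u ≤ -1) (hv : 1 < v) : HasDerivAt (g u) (deriv (g u) v) v :=
  (hg.hasDerivAt_fderivWithin hu hv).differentiableAt.hasDerivAt

lemma deriv_v : SmoothOffCone (fun u v => deriv (g u) v) := by
  have h := hg.fderivWithin uniqueDiffOn (m := (⊤ : ℕ∞)) (by simp)
  refine (h.clm_apply (g := fun _ => ((0 : ℝ), (1 : ℝ))) contDiffOn_const).congr ?_
  rintro ⟨u, v⟩ ⟨hu, hv⟩
  exact (hg.hasDerivAt_fderivWithin hu hv).deriv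

lemma continuousOn_u {v : ℝ} (hv : 1 < v) : ContinuousOn (fun u => g u v) (Iic (-1)) :=
  hg.continuousOn.comp (f := fun u : ℝ => (u, v)) (by fun_prop) fun _ hx => ⟨hx, hv⟩

lemma contDiffAt {p : ℝ × ℝ} (hu : p.1 < -1) (hv : 1 < p.2) :
    ContDiffAt ℝ (⊤ : ℕ∞) (fun p : ℝ × ℝ => g p.1 p.2) p :=
  ContDiffOn.contDiffAt hg (prod_mem_nhds (Iic_mem_nhds hu) (Ioi_mem_nhds hv))

lemma hasDerivAt_u {u v : ℝ} (hu : u < -1) (hv : 1 < v) :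
    HasDerivAt (fun u => g u v) (deriv (fun u => g u v) u) u := by
  have h1 := (hg.contDiffAt (p := (u, v)) hu hv).differentiableAt (by simp)
  have h2 : DifferentiableAt ℝ (fun u : ℝ => (u, v)) u := by fun_prop
  exact (h1.comp (f := fun u : ℝ => (u, v)) u h2).hasDerivAt

/-- Equality of mixed partial derivatives. -/
lemma exists_mixed_deriv {u v : ℝ} (hu : u < -1) (hv : 1 < v) :
    ∃ G : ℝ, HasDerivAt (fun v => deriv (fun u => g u v) u) G v ∧
      HasDerivAt (fun u => deriv (g u) v) G u := by
  set F : ℝ × ℝ → ℝ := fun p => g p.1 p.2 with hF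
  have hsm : ∀ p : ℝ × ℝ, p.1 < -1 → 1 < p.2 → ContDiffAt ℝ (⊤ : ℕ∞) F p :=
    fun p h1 h2 => hg.contDiffAt h1 h2
  have hv' : ∀ p : ℝ × ℝ, p.1 < -1 → 1 < p.2 → deriv (g p.1) p.2 = fderiv ℝ F p (0, 1) := by
    intro p h1 h2
    have h3 := ((hsm p h1 h2).differentiableAt (by simp)).hasFDerivAt
    have h4 : HasDerivAt (fun v : ℝ => (p.1, v)) (0, 1) p.2 :=
      (hasDerivAt_const p.2 p.1).prodMk (hasDerivAt_id p.2)
    exact (h3.comp_hasDerivAt p.2 h4).deriv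
  have hu' : ∀ p : ℝ × ℝ, p.1 < -1 → 1 < p.2 →
      deriv (fun u => g u p.2) p.1 = fderiv ℝ F p (1, 0) := by
    intro p h1 h2
    have h3 := ((hsm p h1 h2).differentiableAt (by simp)).hasFDerivAt
    have h4 : HasDerivAt (fun u : ℝ => (u, p.2)) (1, 0) p.1 :=
      (hasDerivAt_id p.1).prodMk (hasDerivAt_const p.1 p.2)
    exact (h3.comp_hasDerivAt p.1 h4).deriv
  have hp := hsm (u, v) hu hv
  have hsymm := hp.isSymmSndFDerivAt
    (by simpa using WithTop.coe_le_coe.2 (le_top : (2 : ℕ∞) ≤ ⊤)) (0, 1) (1, 0)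
  have hd : HasFDerivAt (fderiv ℝ F) (fderiv ℝ (fderiv ℝ F) (u, v)) (u, v) :=
    ((hp.fderiv_right (m := (⊤ : ℕ∞)) (by simp)).differentiableAt (by simp)).hasFDerivAt
  refine ⟨fderiv ℝ (fderiv ℝ F) (u, v) (0, 1) (1, 0), ?_, ?_⟩
  · have h4 : HasDerivAt (fun v : ℝ => (u, v)) (0, 1) v :=
      (hasDerivAt_const v u).prodMk (hasDerivAt_id v)
    have h5 := (ContinuousLinearMap.apply ℝ ℝ ((1 : ℝ), (0 : ℝ))).hasFDerivAt.comp_hasDerivAt v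
      (hd.comp_hasDerivAt v h4)
    refine h5.congr_of_eventuallyEq ?_
    filter_upwards [Ioi_mem_nhds hv] with x hx
    exact hu' (u, x) hu hx
  · have h4 : HasDerivAt (fun u : ℝ => (u, v)) (1, 0) u :=
      (hasDerivAt_id u).prodMk (hasDerivAt_const u v)
    have h5 := (ContinuousLinearMap.apply ℝ ℝ ((0 : ℝ), (1 : ℝ))).hasFDerivAt.comp_hasDerivAt u
      (hd.comp_hasDerivAt u h4)
    rw [hsymm]
    refine h5.congr_of_eventuallyEq ?_
    filter_upwards [Iio_mem_nhds hu] with x hx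
    exact hv' (x, v) hx hv

end SmoothOffCone

section Commuted

variable {M : ℝ} {r α : ℝ → ℝ → ℝ} {ℓ : ℕ} (hr : IsSchwR M r) (hM : 0 < M) (hM' : M ≤ 1 / 8)

lemma IsSchwR.smoothOffCone (hr : IsSchwR M r) : SmoothOffCone r :=
  hr.smooth.mono fun _ hp => ⟨hp.1, le_of_lt hp.2⟩

lemma baseF_two (r α : ℝ → ℝ → ℝ) : baseF r α 2 = fun u v => r u v ^ 5 * α u v := by
  funext u v
  unfold baseF
  norm_num

include hr hM hM'

lemma smooth_AN {f : ℝ → ℝ → ℝ} (hf : SmoothOffCone f) (N : ℕ) : SmoothOffCone (AN M r f N) := by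
  induction N with
  | zero => exact hf
  | succ N ih =>
    have hs := hr.smoothOffCone
    have h0 : ∀ p ∈ Iic (-1 : ℝ) ×ˢ Ioi (1 : ℝ), r p.1 p.2 ≠ 0 := fun p hp => by
      have := hr.one_le hM hM' hp.1 (le_of_lt hp.2)
      linarith
    refine ContDiffOn.mul (ContDiffOn.div (ContDiffOn.pow hs 2) ?_ ?_) ih.deriv_v
    · exact contDiffOn_const.sub (contDiffOn_const.div hs h0)
    · intro p hp
      have := (hr.Om2_mem hM hM' hp.1 (le_of_lt hp.2)).1
      linarith

lemma hasDerivAt_AN_v {f : ℝ → ℝ → ℝ} (hf : SmoothOffCone f) (N : ℕ) {u v : ℝ} (hu : u ≤ -1)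
    (hv : 1 < v) :
    HasDerivAt (AN M r f N u) (weight M r u v * AN M r f (N + 1) u v) v := by
  refine ((smooth_AN hr hM hM' hf N).hasDerivAt_v hu hv).congr_deriv ?_
  have h1 := hr.one_le hM hM' hu hv.le
  have h2 := (hr.Om2_mem hM hM' hu hv.le).1
  show _ = Om2 M r u v / r u v ^ 2 * (r u v ^ 2 / Om2 M r u v * deriv (AN M r f N u) v)
  have h3 : Om2 M r u v ≠ 0 := by linarith
  field_simp

/-- The commuted Teukolsky equations. -/
lemma deriv_AN_u (hα : SmoothOffCone α) (hT : TeukEq M r α 2 ℓ) (N : ℕ) {u v : ℝ} (hu : u < -1)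
    (hv : 1 < v) :
    deriv (fun u => AN M r (baseF r α 2) (N + 1) u v) u
      = -((N + 3) * weightDeriv M r u v * AN M r (baseF r α 2) (N + 1) u v)
        - ((ℓ - 2 - N) * (ℓ + 3 + N) + (6 * N ^ 2 + 30 * N + 30) * M * (r u v)⁻¹)
            * AN M r (baseF r α 2) N u v
        + 2 * N * (N + 2) * (N + 4) * M * AN M r (baseF r α 2) (N - 1) u v := by
  have hf : SmoothOffCone (baseF r α 2) := by
    rw [baseF_two]
    exact ContDiffOn.mul (ContDiffOn.pow hr.smoothOffCone 5) hα
  induction N generalizing u v with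
  | zero =>
    have h1 := hr.one_le hM hM' hu.le hv.le
    have h2 := (hr.Om2_mem hM hM' hu.le hv.le).1
    have h3 := hT u v ⟨hu.le, hv.le⟩
    have hA := ((smooth_AN hr hM hM' hf 1).hasDerivAt_u hu hv)
    have hw := (hr.hasDerivAt_weight_u hM hM' hu.le hv.le)
    have h4 : (fun u' => (r u' v) ^ (-(2 * 2) : ℤ) * (Om2 M r u' v) ^ (2 : ℤ) *
        deriv (fun v' => baseF r α 2 u' v') v)
        =ᶠ[nhds u] fun u' => weight M r u' v ^ 3 * AN M r (baseF r α 2) 1 u' v := by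
      filter_upwards [Iio_mem_nhds hu] with x hx
      have h1 := hr.one_le hM hM' (le_of_lt hx) hv.le
      have h2 := (hr.Om2_mem hM hM' (le_of_lt hx) hv.le).1
      show _ = (Om2 M r x v / r x v ^ 2) ^ 3 *
        (r x v ^ 2 / Om2 M r x v * deriv (fun v' => baseF r α 2 x v') v)
      have h3 : Om2 M r x v ≠ 0 := by linarith
      have h4 : (r x v) ^ (-(2 * 2) : ℤ) = (r x v ^ 4)⁻¹ := by
        rw [zpow_neg]; norm_num
      have h5 : (Om2 M r x v) ^ (2 : ℤ) = Om2 M r x v ^ 2 := by exact_mod_cast rfl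
      rw [h4, h5]
      field_simp
    rw [h4.deriv_eq, ((hw.fun_pow 3).fun_mul hA).deriv] at h3
    have h5 : (Om2 M r u v) ^ (2 + 1 : ℤ) = Om2 M r u v ^ 3 := by exact_mod_cast rfl
    have h6 : (r u v) ^ (2 * 2 + 2 : ℤ) = r u v ^ 6 := by exact_mod_cast rfl
    have h7 : (r u v) ^ (2 * 2 + 3 : ℤ) = r u v ^ 7 := by exact_mod_cast rfl
    rw [h5, h6, h7] at h3
    have h8 : Om2 M r u v ^ 3 / r u v ^ 6 = weight M r u v ^ 3 := by
      unfold weight; ring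
    have h9 : 2 * M * Om2 M r u v ^ 3 / r u v ^ 7 = 2 * M * weight M r u v ^ 3 * (r u v)⁻¹ := by
      unfold weight; field_simp
    rw [h8, h9] at h3
    have hwp := hr.weight_pos hM hM' hu.le hv.le
    have h10 : weight M r u v ^ 3 ≠ 0 := by positivity
    apply mul_left_cancel₀ h10
    have h11 : AN M r (baseF r α 2) 0 u v = baseF r α 2 u v := rfl
    rw [h11]
    push_cast at h3 ⊢
    linear_combination h3
  | succ N ih =>
    set f := baseF r α 2
    have hd := hasDerivAt_AN_v hr hM hM' hf
    obtain ⟨G, hG1, hG2⟩ := (smooth_AN hr hM hM' hf (N + 1)).exists_mixed_deriv hu hv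
    have hA := ((smooth_AN hr hM hM' hf (N + 2)).hasDerivAt_u hu hv)
    have hw := hr.hasDerivAt_weight_u hM hM' hu.le hv.le
    have hG2' : G = weight M r u v * weightDeriv M r u v * AN M r f (N + 2) u v
        + weight M r u v * deriv (fun u => AN M r f (N + 2) u v) u := by
      refine hG2.unique ((hw.fun_mul hA).congr_of_eventuallyEq ?_)
      filter_upwards [Iio_mem_nhds hu] with x hx
      exact (hd (N + 1) (le_of_lt hx) hv).deriv
    have hx := hr.hasDerivAt_inv_v hM hM' hu.le hv.le
    have hwd := hr.hasDerivAt_weightDeriv_v hM hM' hu.le hv.le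
    have hlast : HasDerivAt (fun v => 2 * N * (N + 2) * (N + 4) * M * AN M r f (N - 1) u v)
        (2 * N * (N + 2) * (N + 4) * M * (weight M r u v * AN M r f N u v)) v := by
      cases N with
      | zero => simpa using hasDerivAt_const v (0 : ℝ)
      | succ N => exact (hd N hu.le hv).const_mul _
    have hG1' := hG1.unique (((((hwd.const_mul (N + 3 : ℝ)).fun_mul
      (hd (N + 1) hu.le hv)).fun_neg.fun_sub
      (((hx.const_mul ((6 * N ^ 2 + 30 * N + 30) * M)).const_add
        (((ℓ : ℝ) - 2 - N) * (ℓ + 3 + N))).fun_mul (hd N hu.le hv))).fun_add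
      hlast).congr_of_eventuallyEq (by
        filter_upwards [Ioi_mem_nhds hv] with y hy
        exact ih hu hy))
    have hwp := hr.weight_pos hM hM' hu.le hv.le
    apply mul_left_cancel₀ hwp.ne'
    rw [Nat.add_sub_cancel]
    push_cast
    linear_combination hG1' - hG2'

/-- The commuted Teukolsky equations in conservative form. -/
lemma hasDerivAt_weight_pow_mul_AN (hα : SmoothOffCone α) (hT : TeukEq M r α 2 ℓ) (N : ℕ)
    {u v : ℝ} (hu : u < -1) (hv : 1 < v) :
    HasDerivAt (fun u => weight M r u v ^ (N + 3) * AN M r (baseF r α 2) (N + 1) u v)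
      (weight M r u v ^ (N + 3) *
        (-(((ℓ - 2 - N) * (ℓ + 3 + N) + (6 * N ^ 2 + 30 * N + 30) * M * (r u v)⁻¹)
            * AN M r (baseF r α 2) N u v)
        + 2 * N * (N + 2) * (N + 4) * M * AN M r (baseF r α 2) (N - 1) u v)) u := by
  have hf : SmoothOffCone (baseF r α 2) := by
    rw [baseF_two]
    exact ContDiffOn.mul (ContDiffOn.pow hr.smoothOffCone 5) hα
  have hA := ((smooth_AN hr hM hM' hf (N + 1)).hasDerivAt_u hu hv)
  rw [deriv_AN_u hr hM hM' hα hT N hu hv] at hA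
  have hw := hr.hasDerivAt_weight_u hM hM' hu.le hv.le
  refine ((hw.fun_pow (N + 3)).fun_mul hA).congr_deriv ?_
  have : N + 3 - 1 = N + 2 := rfl
  rw [this]
  push_cast
  ring

end Commuted

/-- The span of the `∂_vᵏ(rα)` over smooth functions of `1/r`. -/
inductive DerivSpan (r α : ℝ → ℝ → ℝ) : (ℝ → ℝ → ℝ) → Prop
  | iter (k : ℕ) : DerivSpan r α (fun u v => iteratedDeriv k (fun v' => r u v' * α u v') v)
  | add {f g : ℝ → ℝ → ℝ} : DerivSpan r α f → DerivSpan r α g →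
      DerivSpan r α (fun u v => f u v + g u v)
  | mul {q : ℝ → ℝ} {f : ℝ → ℝ → ℝ} : ContDiffOn ℝ (⊤ : ℕ∞) q (Iio 4) → DerivSpan r α f →
      DerivSpan r α (fun u v => q (r u v)⁻¹ * f u v)

section Span

variable {M : ℝ} {r α : ℝ → ℝ → ℝ} (hr : IsSchwR M r) (hM : 0 < M) (hM' : M ≤ 1 / 8)

lemma smooth_iteratedDeriv {g : ℝ → ℝ → ℝ} (hg : SmoothOffCone g) (k : ℕ) :
    SmoothOffCone (fun u v => iteratedDeriv k (g u) v) := by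
  induction k with
  | zero => simpa using hg
  | succ k ih =>
    simp_rw [iteratedDeriv_succ]
    exact ih.deriv_v

include hr hM hM'

lemma IsSchwR.inv_mem {u v : ℝ} (hu : u ≤ -1) (hv : 1 ≤ v) : (r u v)⁻¹ ∈ Iio (4 : ℝ) := by
  have h1 := hr.one_le hM hM' hu hv
  have : (r u v)⁻¹ ≤ 1 := inv_le_one_of_one_le₀ h1
  show _ < (4 : ℝ)
  linarith

lemma DerivSpan.exists_deriv (hα : SmoothOffCone α) {f : ℝ → ℝ → ℝ} (hf : DerivSpan r α f) :
    ∃ f', DerivSpan r α f' ∧ ∀ u v, u ≤ -1 → 1 < v → HasDerivAt (f u) (f' u v) v := by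
  induction hf with
  | iter k =>
    refine ⟨_, DerivSpan.iter (k + 1), fun u v hu hv => ?_⟩
    have hy : SmoothOffCone (fun u v => r u v * α u v) := ContDiffOn.mul hr.smoothOffCone hα
    rw [iteratedDeriv_succ]
    exact (smooth_iteratedDeriv hy k).hasDerivAt_v hu hv
  | add _ _ ihf ihg =>
    obtain ⟨f', hf', hfd⟩ := ihf
    obtain ⟨g', hg', hgd⟩ := ihg
    exact ⟨_, hf'.add hg', fun u v hu hv => (hfd u v hu hv).fun_add (hgd u v hu hv)⟩
  | @mul q f hq hf ih =>
    obtain ⟨f', hf', hfd⟩ := ih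
    have hq1 : ContDiffOn ℝ (⊤ : ℕ∞) (fun x => -(deriv q x * (x ^ 2 - 2 * M * x ^ 3))) (Iio 4) :=
      ((hq.deriv_of_isOpen isOpen_Iio (m := (⊤ : ℕ∞)) (by simp)).mul
        (by fun_prop : ContDiff ℝ (⊤ : ℕ∞) (fun x : ℝ => x ^ 2 - 2 * M * x ^ 3)).contDiffOn).neg
    refine ⟨_, (hf.mul hq1).add (hf'.mul hq), fun u v hu hv => ?_⟩
    have hx := hr.inv_mem hM hM' hu hv.le
    have hqd : HasDerivAt q (deriv q (r u v)⁻¹) (r u v)⁻¹ :=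
      ((hq.contDiffAt (isOpen_Iio.mem_nhds hx)).differentiableAt (by simp)).hasDerivAt
    refine ((hqd.comp v (hr.hasDerivAt_inv_v hM hM' hu hv.le)).mul (hfd u v hu hv)).congr_deriv ?_
    rw [IsSchwR.weight_eq, Function.comp]
    ring

lemma DerivSpan.tendsto_zero
    (hlim : ∀ k : ℕ, ∀ v : ℝ, 1 < v →
      Tendsto (fun u => iteratedDeriv k (fun v' => r u v' * α u v') v) atBot (nhds 0))
    {f : ℝ → ℝ → ℝ} (hf : DerivSpan r α f) {v : ℝ} (hv : 1 < v) :
    Tendsto (fun u => f u v) atBot (nhds 0) := by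
  induction hf with
  | iter k => exact hlim k v hv
  | add _ _ ihf ihg => simpa using ihf.add ihg
  | @mul q f hq _ ih =>
    have hx : Tendsto (fun u => (r u v)⁻¹) atBot (nhds 0) :=
      (hr.decay_inv hM hM' univ).tendsto_atBot (by norm_num) hv.le (mem_univ v)
    have hq0 : ContinuousAt q 0 :=
      hq.continuousOn.continuousAt (isOpen_Iio.mem_nhds (by norm_num))
    simpa using (hq0.tendsto.comp hx).mul ih

lemma exists_AN_eq (hα : SmoothOffCone α) (N : ℕ) :
    ∃ Z, DerivSpan r α Z ∧ ∀ u v, u ≤ -1 → 1 < v →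
      AN M r (baseF r α 2) N u v = r u v ^ (2 * N + 4) * Z u v := by
  induction N with
  | zero =>
    refine ⟨_, DerivSpan.iter 0, fun u v _ _ => ?_⟩
    show baseF r α 2 u v = _
    rw [baseF_two, iteratedDeriv_zero]
    ring
  | succ N ih =>
    obtain ⟨Z, hZ, hAZ⟩ := ih
    obtain ⟨Z', hZ', hZd⟩ := hZ.exists_deriv hr hM hM' hα
    have hq1 : ContDiffOn ℝ (⊤ : ℕ∞) (fun x : ℝ => (2 * N + 4) * x) (Iio 4) := by fun_prop
    have hq2 : ContDiffOn ℝ (⊤ : ℕ∞) (fun x : ℝ => (1 - 2 * M * x)⁻¹) (Iio 4) := by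
      refine ContDiffOn.inv (by fun_prop) fun x hx => ?_
      have hx : x < 4 := hx
      nlinarith
    refine ⟨_, (hZ.mul hq1).add (hZ'.mul hq2), fun u v hu hv => ?_⟩
    have h1 := hr.one_le hM hM' hu hv.le
    have h2 := (hr.Om2_mem hM hM' hu hv.le).1
    have hd := ((hr.hasDerivAt_v hM hM' hu hv.le).fun_pow (2 * N + 4)).fun_mul (hZd u v hu hv)
    have hd' : deriv (AN M r (baseF r α 2) N u) v = _ :=
      (hd.congr_of_eventuallyEq (by
        filter_upwards [Ioi_mem_nhds hv] with y hy
        exact hAZ u y hu hy)).deriv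
    show r u v ^ 2 / Om2 M r u v * deriv (AN M r (baseF r α 2) N u) v = _
    have h3 : Om2 M r u v ≠ 0 := by linarith
    have h4 : 1 - 2 * M * (r u v)⁻¹ = Om2 M r u v := by unfold Om2; ring
    rw [hd', h4]
    have h5 : 2 * N + 4 - 1 = 2 * N + 3 := rfl
    rw [h5]
    field_simp
    push_cast
    ring

lemma tendsto_weight_pow_mul_AN (hα : SmoothOffCone α)
    (hlim : ∀ k : ℕ, ∀ v : ℝ, 1 < v →
      Tendsto (fun u => iteratedDeriv k (fun v' => r u v' * α u v') v) atBot (nhds 0))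
    (N : ℕ) {v : ℝ} (hv : 1 < v) :
    Tendsto (fun u => weight M r u v ^ (N + 2) * AN M r (baseF r α 2) N u v) atBot (nhds 0) := by
  obtain ⟨Z, hZ, hAZ⟩ := exists_AN_eq hr hM hM' hα N
  refine squeeze_zero_norm' ?_ (tendsto_zero_iff_norm_tendsto_zero.1
    (hZ.tendsto_zero hr hM hM' hlim hv))
  filter_upwards [eventually_le_atBot (-1 : ℝ)] with u hu
  have h1 := hr.one_le hM hM' hu hv.le
  obtain ⟨h2, h3⟩ := hr.Om2_mem hM hM' hu hv.le
  have h4 : weight M r u v ^ (N + 2) * (r u v ^ (2 * N + 4) * Z u v)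
      = Om2 M r u v ^ (N + 2) * Z u v := by
    have h5 : r u v ≠ 0 := by linarith
    rw [weight, div_pow, ← pow_mul, show 2 * (N + 2) = 2 * N + 4 by ring]
    field_simp
  rw [hAZ u v hu hv, h4, norm_mul]
  refine mul_le_of_le_one_left (norm_nonneg _) ?_
  rw [Real.norm_of_nonneg (by positivity)]
  exact pow_le_one₀ (by linarith) h3

end Span

section Estimates

variable {M : ℝ} {r α : ℝ → ℝ → ℝ} {n : ℕ} {A B C ε C₀ C₁ : ℝ}
  (hr : IsSchwR M r) (hM : 0 < M) (hM' : M ≤ 1 / 8)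
  (hα : ContDiffOn ℝ (⊤ : ℕ∞) (fun p : ℝ × ℝ => α p.1 p.2) D)
  (hT : TeukEq M r α 2 (n + 2)) (hdata : PlusData M r α (n + 2) A B C ε C₀ C₁)

lemma smoothOffCone_of_D {g : ℝ → ℝ → ℝ}
    (hg : ContDiffOn ℝ (⊤ : ℕ∞) (fun p : ℝ × ℝ => g p.1 p.2) D) : SmoothOffCone g :=
  hg.mono fun _ hp => ⟨hp.1, le_of_lt hp.2⟩

lemma smooth_baseF (hr : IsSchwR M r) (hα : SmoothOffCone α) : SmoothOffCone (baseF r α 2) := by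
  rw [baseF_two]
  exact ContDiffOn.mul (ContDiffOn.pow hr.smoothOffCone 5) hα

lemma smooth_weight_pow_mul_AN (hr : IsSchwR M r) (hM : 0 < M) (hM' : M ≤ 1 / 8)
    (hα : SmoothOffCone α) (j N : ℕ) :
    SmoothOffCone (fun u v => weight M r u v ^ j * AN M r (baseF r α 2) N u v) := by
  have hs := hr.smoothOffCone
  have h0 : ∀ p ∈ Iic (-1 : ℝ) ×ˢ Ioi (1 : ℝ), r p.1 p.2 ≠ 0 := fun p hp => by
    have := hr.one_le hM hM' hp.1 (le_of_lt hp.2)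
    linarith
  refine ContDiffOn.mul (ContDiffOn.pow (ContDiffOn.div
    (contDiffOn_const.sub (contDiffOn_const.div hs h0)) (ContDiffOn.pow hs 2) ?_) j)
    (smooth_AN hr hM hM' (smooth_baseF hr hα) N)
  exact fun p hp => pow_ne_zero 2 (h0 p hp)

include hr hM hM' hdata

lemma decay_AN {N : ℕ} (hN : N ≤ n) :
    DecayBound (Ioi 1) (AN M r (baseF r α 2) N) (N + 2) := by
  have hC₁ := hdata.hC₁
  refine ⟨C₁ * 3, by positivity, fun u v hu hv _ => ?_⟩
  have h1 := hr.one_le hM hM' hu hv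
  have h2 := hr.le_sub hM hM' hu hv
  have h3 : 0 ≤ Real.log (2 + r u v) := Real.log_nonneg (by linarith)
  have h4 : Real.log (2 + r u v) ^ 2 ≤ 12 * r u v := by
    have h5 := Real.log_le_sub_one_of_pos (Real.sqrt_pos.2 (by linarith : 0 < 2 + r u v))
    rw [Real.log_sqrt (by linarith)] at h5
    have h6 : Real.log (2 + r u v) ≤ 2 * √(2 + r u v) := by linarith
    have h7 := pow_le_pow_left₀ h3 h6 2
    rw [mul_pow, Real.sq_sqrt (by linarith)] at h7
    linarith
  have h5 : u ^ 2 + M * r u v * Real.log (2 + r u v) ^ 2 ≤ 3 * (v - u) ^ 2 := by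
    have h6 : M * r u v * Real.log (2 + r u v) ^ 2 ≤ 1 / 8 * r u v * (12 * r u v) := by gcongr
    nlinarith
  have h6 : (v - u) ^ (N + 2 : ℝ) = (v - u) ^ N * (v - u) ^ 2 := by
    rw [Real.rpow_add (by linarith)]
    norm_num
  have h7 : 0 ≤ v - u := by linarith
  calc _ ≤ C₁ * r u v ^ N * (u ^ 2 + M * r u v * Real.log (2 + r u v) ^ 2) :=
        hdata.apriori N (by omega) u v ⟨hu, hv⟩
    _ ≤ C₁ * (v - u) ^ N * (3 * (v - u) ^ 2) := by gcongr
    _ = _ := by rw [h6]; ring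

lemma decay_mul_AN_pred {N : ℕ} (hN : N ≤ n) :
    DecayBound (Ioi 1) (fun u v => 2 * N * (N + 2) * (N + 4) * M * AN M r (baseF r α 2) (N - 1) u v)
      (N + 1) := by
  cases N with
  | zero =>
    refine ((DecayBound.const _ 0).congr (fun _ _ _ _ _ => ?_)).mono (by norm_num)
    simp
  | succ N =>
    refine ((decay_AN hr hM hM' hdata (by omega : N ≤ n)).const_mul _).mono (le_of_eq ?_)
    push_cast
    ring

lemma tendsto_iteratedDeriv (k : ℕ) (v : ℝ) (hv : 1 < v) :
    Tendsto (fun u => iteratedDeriv k (fun v' => r u v' * α u v') v) atBot (nhds 0) := by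
  rcases Nat.eq_zero_or_pos k with rfl | hk
  · have h1 := (decay_AN hr hM hM' hdata (Nat.zero_le n)).mul
      ((hr.decay_inv hM hM' (Ioi 1)).pow 4)
    refine (h1.congr (g := fun u v => r u v * α u v) fun u v hu hv _ => ?_).tendsto_atBot
      (by norm_num) hv.le hv
    have h2 := hr.one_le hM hM' hu hv
    show _ = baseF r α 2 u v * _
    rw [baseF_two]
    field_simp
  · exact hdata.noincoming k hk v hv.le

include hα hT

lemma decay_AN_succ : DecayBound (Ioi 1) (AN M r (baseF r α 2) (n + 1)) (n + 2) := by
  have hα' := smoothOffCone_of_D hα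
  have key : DecayBound (Ioi 1)
      (fun u v => weight M r u v ^ (n + 3) * AN M r (baseF r α 2) (n + 1) u v) (-(n + 4)) := by
    refine DecayBound.of_deriv_u (g' := fun u v => weight M r u v ^ (n + 3) *
        (-((6 * n ^ 2 + 30 * n + 30) * M * ((r u v)⁻¹ * AN M r (baseF r α 2) n u v))
        + 2 * n * (n + 2) * (n + 4) * M * AN M r (baseF r α 2) (n - 1) u v)) (by positivity)
      (fun v _ hv => (smooth_weight_pow_mul_AN hr hM hM' hα' _ _).continuousOn_u hv)
      (fun u v hu _ hv => ?_)
      (fun v _ hv => ?_) ?_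
    · refine (hasDerivAt_weight_pow_mul_AN hr hM hM' hα' hT n hu hv).congr_deriv ?_
      push_cast
      ring
    · exact tendsto_weight_pow_mul_AN hr hM hM' hα'
        (tendsto_iteratedDeriv hr hM hM' hdata) (n + 1) hv
    · have h1 := ((hr.decay_inv hM hM' (Ioi 1)).mul
        (decay_AN hr hM hM' hdata (le_refl n))).const_mul ((6 * n ^ 2 + 30 * n + 30) * M)
      have h2 := (h1.mono (q := n + 1) (by linarith)).neg.add
        (decay_mul_AN_pred hr hM hM' hdata (le_refl n))
      refine ((hr.decay_weight_pow hM hM' (Ioi 1) (n + 3)).mul h2).mono (le_of_eq ?_)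
      push_cast
      ring
  have h1 := ((hr.decay_weight_inv hM hM' (Ioi 1)).pow (n + 3)).mul key
  refine (h1.congr (g := AN M r (baseF r α 2) (n + 1)) fun u v hu hv _ => ?_).mono
    (le_of_eq (by push_cast; ring))
  have := hr.weight_pos hM hM' hu hv
  rw [inv_pow, inv_mul_cancel_left₀ (pow_ne_zero _ this.ne')]

end Estimates

namespace DecayBound

variable {S : Set ℝ} {f g F G : ℝ → ℝ → ℝ} {p p' q q' s : ℝ}

lemma mul_sub_mul (hfF : DecayBound S (fun u v => f u v - F u v) p) (hg : DecayBound S g q)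
    (hF : DecayBound S F p') (hgG : DecayBound S (fun u v => g u v - G u v) q')
    (h : p + q ≤ s) (h' : p' + q' ≤ s) :
    DecayBound S (fun u v => f u v * g u v - F u v * G u v) s :=
  (((hfF.mul hg).mono h).add ((hF.mul hgG).mono h')).congr fun _ _ _ _ _ => by ring

lemma pow_sub (S : Set ℝ) (m : ℕ) : DecayBound S (fun u v => (v - u) ^ m) m :=
  (rpow S m).congr fun _ _ _ _ _ => (Real.rpow_natCast _ m).symm

lemma inv_pow_sub (S : Set ℝ) (m : ℕ) : DecayBound S (fun u v => (v - u)⁻¹ ^ m) (-m) :=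
  (rpow S (-m)).congr fun u v hu hv _ => by
    rw [Real.rpow_neg (by linarith), Real.rpow_natCast, inv_pow]

lemma two_sub (S : Set ℝ) : DecayBound S (fun u _ => 2 - u) 1 :=
  of_pos (g := fun u v => 2 * (v - u) ^ (1 : ℝ)) (fun u v hu hv _ => by
    rw [Real.rpow_one, abs_of_nonneg (by linarith), abs_of_nonneg (by linarith)]
    linarith) ((rpow S 1).const_mul 2)

end DecayBound

lemma hasDerivAt_inv_pow_sub_left {u v : ℝ} (h : v - u ≠ 0) (m : ℕ) :
    HasDerivAt (fun u => (v - u)⁻¹ ^ m) (m * (v - u)⁻¹ ^ (m + 1)) u := by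
  refine ((((hasDerivAt_id' u).const_sub v).fun_inv h).fun_pow m).congr_deriv ?_
  cases m with
  | zero => simp
  | succ m =>
    rw [Nat.add_sub_cancel, neg_neg, one_div, ← inv_pow]
    ring

lemma hasDerivAt_inv_sub_right {u v : ℝ} (h : v - u ≠ 0) :
    HasDerivAt (fun v => (v - u)⁻¹) (-(v - u)⁻¹ ^ 2) v := by
  refine (((hasDerivAt_id' v).sub_const u).fun_inv h).congr_deriv ?_
  field_simp

/-- The coefficients of the leading terms `k_N (v - u)^(N + 2)` of `A^{[+2],N}` on `v = 2`. -/
def leadCoeff (n : ℕ) (A : ℝ) : ℕ → ℝ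
  | 0 => A
  | N + 1 => -((n - N) * (n + 5 + N) / (N + 3) * leadCoeff n A N)

section InitialData

variable {M : ℝ} {r α : ℝ → ℝ → ℝ} {n : ℕ} {A B C ε C₀ C₁ : ℝ}
  (hr : IsSchwR M r) (hM : 0 < M) (hM' : M ≤ 1 / 8)
  (hα : ContDiffOn ℝ (⊤ : ℕ∞) (fun p : ℝ × ℝ => α p.1 p.2) D)
  (hT : TeukEq M r α 2 (n + 2)) (hdata : PlusData M r α (n + 2) A B C ε C₀ C₁)

include hr hM hM'

lemma decay_weight_pow_sub_inv (S : Set ℝ) (m : ℕ) :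
    DecayBound S (fun u v => weight M r u v ^ m - (v - u)⁻¹ ^ (2 * m)) (-2 * m - 1 / 2) :=
  (hr.decay_weight_pow_sub hM hM' S m).congr fun u v hu hv _ => by
    rw [show (-2 * m : ℝ) = -((2 * m : ℕ) : ℝ) by push_cast; ring, Real.rpow_neg (by linarith),
      Real.rpow_natCast, inv_pow]

include hdata

lemma decay_baseF_sub_one :
    DecayBound {1} (fun u v => baseF r α 2 u v - A * (v - u) ^ 2) (3 / 2) := by
  set K := (1 / 6) * ((Nat.factorial (n + 2 + 2) : ℝ) / (Nat.factorial (n + 2 - 2) : ℝ)) * B with hK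
  have hx := hr.decay_inv hM hM' {1}
  have hr1 := hr.decay_r hM hM' {1}
  have hE : DecayBound {1} (fun u v => α u v - A * r u v ^ (-3 : ℤ)
      + K * r u v ^ (-4 : ℤ) * Real.log (r u v) - C * r u v ^ (-4 : ℤ)) ((4 : ℕ) * (-1)) := by
    refine DecayBound.of_pos (fun u v hu hv hS => ?_) ((hx.pow 4).const_mul C₀)
    obtain rfl : v = 1 := hS
    refine (hdata.data u hu).trans ?_
    have h1 := hr.one_le hM hM' hu le_rfl
    have hC := hdata.hC₀
    have h2 : r u 1 ^ (-4 - ε) ≤ (r u 1)⁻¹ ^ 4 := by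
      have : (r u 1)⁻¹ ^ 4 = r u 1 ^ (-4 : ℝ) := by
        rw [Real.rpow_neg (by linarith), inv_pow]
        norm_cast
      rw [this]
      exact Real.rpow_le_rpow_of_exponent_le h1 (by linarith [hdata.hε.1])
    rw [abs_of_nonneg (by positivity)]
    gcongr
  have hlog : DecayBound {1} (fun u v => Real.log (r u v)) (1 / 2) := by
    refine DecayBound.of_pos (fun u v hu hv _ => ?_)
      ((DecayBound.rpow {1} (1 / 2)).const_mul 2)
    have h1 := hr.one_le hM hM' hu hv
    have h2 := hr.le_sub hM hM' hu hv
    rw [abs_of_nonneg (Real.log_nonneg h1),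
      abs_of_nonneg (mul_nonneg zero_le_two (Real.rpow_nonneg (by linarith) _))]
    have h3 := Real.log_le_rpow_div (by linarith : 0 ≤ r u v) (by norm_num : (0 : ℝ) < 1 / 2)
    have h4 : r u v ^ (1 / 2 : ℝ) ≤ (v - u) ^ (1 / 2 : ℝ) := by gcongr
    linarith
  have h1 := (hE.mul (hr1.pow 5)).mono (q := 3 / 2) (by norm_num)
  have h2 := ((hlog.mul hr1).const_mul K).mono (q := 3 / 2) (by norm_num)
  have h3 := (hr1.const_mul C).mono (q := 3 / 2) (by norm_num)
  have h4 := (((hr.decay_r_sub hM hM' {1}).mul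
    (hr1.add ((DecayBound.pow_sub {1} 1).mono (by norm_num)))).const_mul A).mono
      (q := 3 / 2) (by norm_num)
  refine (((h1.sub h2).add h3).add h4).congr fun u v hu hv _ => ?_
  have := hr.one_le hM hM' hu hv
  rw [baseF_two, show r u v ^ (-3 : ℤ) = (r u v)⁻¹ ^ 3 by rw [inv_pow]; rfl,
    show r u v ^ (-4 : ℤ) = (r u v)⁻¹ ^ 4 by rw [inv_pow]; rfl]
  field_simp
  ring

include hα hT

lemma decay_baseF_sub_two :
    DecayBound {2} (fun u v => baseF r α 2 u v - A * (v - u) ^ 2) (3 / 2) := by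
  have hα' := smoothOffCone_of_D hα
  have hA1 : DecayBound (Ioi 1) (AN M r (baseF r α 2) 1) 3 := by
    rcases Nat.eq_zero_or_pos n with rfl | hn
    · exact (decay_AN_succ hr hM hM' hα hT hdata).mono (by norm_num)
    · exact (decay_AN hr hM hM' hdata (N := 1) hn).mono (by norm_num)
  obtain ⟨K, hK, hKb⟩ := ((hr.decay_weight hM hM' (Ioi 1)).mul hA1).mono (q := 3 / 2) (by norm_num)
  obtain ⟨K', hK', hKb'⟩ := decay_baseF_sub_one hr hM hM' hdata
  refine ⟨K + K' + |A| * 2, by positivity, fun u v hu _ hS => ?_⟩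
  obtain rfl : v = 2 := hS
  have hcont : ContinuousOn (fun v => baseF r α 2 u v) (Icc 1 2) := by
    rw [baseF_two]
    have h : ContinuousOn (fun p : ℝ × ℝ => r p.1 p.2 ^ 5 * α p.1 p.2) D :=
      (hr.smooth.continuousOn.pow 5).mul hα.continuousOn
    exact ContinuousOn.comp (f := fun v => (u, v)) h (by fun_prop) fun v hv => ⟨hu, hv.1⟩
  obtain ⟨c, hc, hc'⟩ := exists_hasDerivAt_eq_slope (fun v => baseF r α 2 u v)
    (fun v => weight M r u v * AN M r (baseF r α 2) 1 u v) one_lt_two hcont fun v hv =>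
    hasDerivAt_AN_v hr hM hM' (smooth_baseF hr hα') 0 hu hv.1
  have h1 := hKb u c hu hc.1.le hc.1
  have h2 := hKb' u 1 hu le_rfl rfl
  have h3 : (c - u) ^ (3 / 2 : ℝ) ≤ (2 - u) ^ (3 / 2 : ℝ) := by
    gcongr
    · linarith [hc.1]
    · exact hc.2.le
  have h4 : (1 - u) ^ (3 / 2 : ℝ) ≤ (2 - u) ^ (3 / 2 : ℝ) := by
    gcongr
    linarith
  have h5 : 2 - u ≤ (2 - u) ^ (3 / 2 : ℝ) := by
    conv_lhs => rw [← Real.rpow_one (2 - u)]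
    exact Real.rpow_le_rpow_of_exponent_le (by linarith) (by norm_num)
  have h6 : baseF r α 2 u 2 - A * (2 - u) ^ 2
      = weight M r u c * AN M r (baseF r α 2) 1 u c
        + (baseF r α 2 u 1 - A * (1 - u) ^ 2) + -(A * (3 - 2 * u)) := by
    rw [hc']
    ring
  have h7 : |-(A * (3 - 2 * u))| ≤ |A| * 2 * (2 - u) ^ (3 / 2 : ℝ) := by
    rw [abs_neg, abs_mul, abs_of_nonneg (by linarith : 0 ≤ 3 - 2 * u), mul_assoc]
    gcongr
    linarith
  beta_reduce at h1 h2 ⊢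
  rw [h6]
  refine (abs_add_three _ _ _).trans ?_
  have h8 := mul_le_mul_of_nonneg_left h3 hK
  have h9 := mul_le_mul_of_nonneg_left h4 hK'
  linarith

lemma decay_AN_sub_two {N : ℕ} (hN : N ≤ n) :
    DecayBound {2} (fun u v => AN M r (baseF r α 2) N u v
      - leadCoeff n A N * (v - u) ^ (N + 2)) (N + 3 / 2) := by
  have hα' := smoothOffCone_of_D hα
  have h21 : ({2} : Set ℝ) ⊆ Ioi 1 := by simp
  induction N with
  | zero =>
    exact (decay_baseF_sub_two hr hM hM' hα hT hdata).mono (by norm_num)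
  | succ N ih =>
    have ih := ih (by omega)
    have hw := decay_weight_pow_sub_inv hr hM hM' {2} (N + 3)
    have hAN := (decay_AN hr hM hM' hdata (by omega : N ≤ n)).subset h21
    have key : DecayBound {2} (fun u v =>
        weight M r u v ^ (N + 3) * AN M r (baseF r α 2) (N + 1) u v
        - leadCoeff n A (N + 1) * (v - u)⁻¹ ^ (N + 3)) (-(N + 7 / 2)) := by
      refine DecayBound.of_deriv_u (g' := fun u v =>
          -((n - N) * (n + 5 + N) * (weight M r u v ^ (N + 3) * AN M r (baseF r α 2) N u v
            - (v - u)⁻¹ ^ (2 * (N + 3)) * (leadCoeff n A N * (v - u) ^ (N + 2))))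
          + weight M r u v ^ (N + 3) * (2 * N * (N + 2) * (N + 4) * M
              * AN M r (baseF r α 2) (N - 1) u v
            - (6 * N ^ 2 + 30 * N + 30) * M * ((r u v)⁻¹ * AN M r (baseF r α 2) N u v)))
        (by positivity) (fun v hv hS => ?_) (fun u v hu hv hS => ?_) (fun v hv hS => ?_) ?_
      · refine ((smooth_weight_pow_mul_AN hr hM hM' hα' _ _).continuousOn_u (h21 hS)).sub ?_
        refine continuousOn_const.mul (ContinuousOn.pow (ContinuousOn.inv₀ (by fun_prop) ?_) _)
        intro u hu
        have hu : u ≤ -1 := hu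
        linarith
      · have h1 := hasDerivAt_weight_pow_mul_AN hr hM hM' hα' hT N hu (h21 hS)
        have h2 := (hasDerivAt_inv_pow_sub_left (by linarith : v - u ≠ 0) (N + 3)).const_mul
          (leadCoeff n A (N + 1))
        refine (h1.sub h2).congr_deriv ?_
        have h3 : v - u ≠ 0 := by linarith
        have h4 : (v - u)⁻¹ ^ (2 * (N + 3)) * (leadCoeff n A N * (v - u) ^ (N + 2))
            = leadCoeff n A N * (v - u)⁻¹ ^ (N + 4) := by
          rw [show 2 * (N + 3) = (N + 2) + (N + 4) by ring, pow_add, inv_pow (v - u) (N + 2)]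
          field_simp
        have h5 : leadCoeff n A (N + 1) * (N + 3)
            = -((n - N) * (n + 5 + N) * leadCoeff n A N) := by
          rw [leadCoeff]
          field_simp
        rw [h4]
        push_cast
        linear_combination (-(v - u)⁻¹ ^ (N + 4)) * h5
      · have h1 := ((hr.decay_weight_pow hM hM' (Ioi 1) (N + 3)).mul
          (decay_AN hr hM hM' hdata hN)).mono (q := -(N + 3)) (by push_cast; linarith)
        have h2 := ((DecayBound.inv_pow_sub (Ioi 1) (N + 3)).const_mul
          (leadCoeff n A (N + 1))).mono (q := -(N + 3)) (by push_cast; linarith)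
        exact (h1.sub h2).tendsto_atBot (by linarith [(N.cast_nonneg : (0 : ℝ) ≤ N)]) hv (h21 hS)
      · have h1 := hw.mul_sub_mul hAN (DecayBound.inv_pow_sub _ _) ih (s := -(N + 7 / 2) - 1)
          (by push_cast; linarith) (by push_cast; linarith)
        have h2 := ((hr.decay_inv hM hM' {2}).mul hAN).const_mul ((6 * N ^ 2 + 30 * N + 30) * M)
        have h3 := ((decay_mul_AN_pred hr hM hM' hdata (by omega : N ≤ n)).subset h21).sub
          (h2.mono (by linarith))
        exact (h1.const_mul _).neg.add (((hr.decay_weight_pow hM hM' {2} (N + 3)).mul h3).mono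
          (by push_cast; linarith))
    have hwi := (hr.decay_weight_inv hM hM' {2}).pow (N + 3)
    have h1 := (hwi.mul key).mono (q := N + 5 / 2) (by push_cast; linarith)
    have h2 := (((hwi.mul hw).mul (DecayBound.pow_sub {2} (N + 3))).const_mul
      (leadCoeff n A (N + 1))).mono (q := N + 5 / 2) (by push_cast; linarith)
    refine ((h1.sub h2).congr fun u v hu hv _ => ?_).mono (by push_cast; linarith)
    have h3 := pow_ne_zero (N + 3) (hr.weight_pos hM hM' hu hv).ne'
    have h4 : v - u ≠ 0 := by linarith
    rw [show 2 * (N + 3) = (N + 3) + (N + 3) by ring, pow_add (v - u)⁻¹ (N + 3), inv_pow (v - u),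
      inv_pow (weight M r u v)]
    field_simp
    ring

end InitialData

/-- The incomplete beta function `∫_s^1 σ^(n+2) (1-σ)^(n+3) dσ`. -/
def betaTail (n : ℕ) (s : ℝ) : ℝ := ∫ x in s..1, x ^ (n + 2) * (1 - x) ^ (n + 3)

lemma hasDerivAt_betaTail (n : ℕ) (s : ℝ) :
    HasDerivAt (betaTail n) (-(s ^ (n + 2) * (1 - s) ^ (n + 3))) s := by
  have hc : Continuous fun x : ℝ => x ^ (n + 2) * (1 - x) ^ (n + 3) := by fun_prop
  exact intervalIntegral.integral_hasDerivAt_left (hc.intervalIntegrable _ _)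
    (hc.stronglyMeasurableAtFilter _ _) hc.continuousAt

lemma continuous_betaTail (n : ℕ) : Continuous (betaTail n) :=
  continuous_iff_continuousAt.2 fun s => (hasDerivAt_betaTail n s).continuousAt

lemma betaTail_zero (n : ℕ) :
    betaTail n 0 = ((n + 2).factorial * (n + 3).factorial : ℝ) / (2 * n + 6).factorial := by
  rw [betaTail, integral_pow_mul_one_sub_pow, show n + 2 + (n + 3) + 1 = 2 * n + 6 by ring]

/-- The source of the leading-order transport equation for `A^{[+2],n+1}`, integrated in `u`. -/
def leadProfile (n : ℕ) (d e u v : ℝ) : ℝ :=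
  (-d + e / (n + 2)) * (betaTail n ((2 - u) * (v - u)⁻¹) * (v - 2)⁻¹ ^ (n + 4))
    - e / (2 * (n + 2)) * ((2 - u) ^ (n + 2) * (v - u)⁻¹ ^ (2 * n + 6))

lemma hasDerivAt_leadProfile (n : ℕ) (d e : ℝ) {u v : ℝ} (hu : u ≤ -1) (hv : 2 < v) :
    HasDerivAt (fun u => leadProfile n d e u v)
      (-d * ((v - u)⁻¹ ^ (2 * n + 7) * (2 - u) ^ (n + 2))
        + e * ((v - u)⁻¹ ^ (2 * n + 6) * ((2 - u) ^ (n + 1) / 2 - (2 - u) ^ (n + 2) * (v - u)⁻¹)))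
      u := by
  have h0 : v - u ≠ 0 := by linarith
  have hV : v - 2 ≠ 0 := by linarith
  have hU := (hasDerivAt_id' u).const_sub 2
  have hy := hasDerivAt_inv_pow_sub_left h0 1
  simp only [pow_one] at hy
  have hQ := (((hasDerivAt_betaTail n _).comp u (hU.fun_mul hy)).mul_const
    ((v - 2)⁻¹ ^ (n + 4))).const_mul (-d + e / (n + 2))
  have hP := ((hU.fun_pow (n + 2)).fun_mul
    (hasDerivAt_inv_pow_sub_left h0 (2 * n + 6))).const_mul (e / (2 * (n + 2)))
  refine (hQ.sub hP).congr_deriv ?_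
  have h1 : 1 - (2 - u) * (v - u)⁻¹ = (v - 2) * (v - u)⁻¹ := by field_simp; ring
  have h2 : -1 * (v - u)⁻¹ + (2 - u) * ((1 : ℕ) * (v - u)⁻¹ ^ (1 + 1))
      = -((v - 2) * (v - u)⁻¹ ^ 2) := by
    push_cast
    linear_combination (v - u)⁻¹ * mul_inv_cancel₀ h0
  have h3 : -(((2 - u) * (v - u)⁻¹) ^ (n + 2) * (1 - (2 - u) * (v - u)⁻¹) ^ (n + 3))
      * (-1 * (v - u)⁻¹ + (2 - u) * ((1 : ℕ) * (v - u)⁻¹ ^ (1 + 1))) * (v - 2)⁻¹ ^ (n + 4)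
      = (2 - u) ^ (n + 2) * (v - u)⁻¹ ^ (2 * n + 7) := by
    have h4 : (v - 2) ^ (n + 4) * (v - 2)⁻¹ ^ (n + 4) = 1 := by
      rw [← mul_pow, mul_inv_cancel₀ hV, one_pow]
    rw [h1, h2, mul_pow, mul_pow]
    linear_combination ((2 - u) ^ (n + 2) * (v - u)⁻¹ ^ (2 * n + 7)) * h4
  rw [h3]
  have h5 : (n : ℝ) + 2 ≠ 0 := by positivity
  simp only [Nat.add_succ_sub_one]
  push_cast
  generalize (v - u)⁻¹ = y
  field_simp
  ring

section Interior

variable {M : ℝ} {r α : ℝ → ℝ → ℝ} {n : ℕ} {A B C ε C₀ C₁ : ℝ}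
  (hr : IsSchwR M r) (hM : 0 < M) (hM' : M ≤ 1 / 8)
  (hα : ContDiffOn ℝ (⊤ : ℕ∞) (fun p : ℝ × ℝ => α p.1 p.2) D)
  (hT : TeukEq M r α 2 (n + 2)) (hdata : PlusData M r α (n + 2) A B C ε C₀ C₁)

include hr hM hM' hα hT hdata

lemma decay_AN_sub :
    DecayBound (Ici 2) (fun u v => AN M r (baseF r α 2) n u v
      - leadCoeff n A n * (2 - u) ^ (n + 2)) (n + 3 / 2) := by
  have h21 : Ici (2 : ℝ) ⊆ Ioi 1 := fun v (hv : 2 ≤ v) => show 1 < v by linarith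
  have hα' := smooth_baseF hr (smoothOffCone_of_D hα)
  refine DecayBound.of_deriv_v (by positivity) (fun u v hu hv =>
      (hasDerivAt_AN_v hr hM hM' hα' n hu (h21 hv)).sub_const _) ?_ ?_
  · exact ((hr.decay_weight hM hM' _).mul
      ((decay_AN_succ hr hM hM' hα hT hdata).subset h21)).mono (by linarith)
  · refine (decay_AN_sub_two hr hM hM' hα hT hdata le_rfl).congr fun u v _ _ hv => ?_
    obtain rfl : v = 2 := hv
    rfl

lemma decay_AN_pred_sub :
    DecayBound (Ici 2) (fun u v => 2 * n * (n + 2) * (n + 4) * AN M r (baseF r α 2) (n - 1) u v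
      - 2 * n * (n + 2) * (n + 4) * leadCoeff n A n *
        ((2 - u) ^ (n + 1) / 2 - (2 - u) ^ (n + 2) * (v - u)⁻¹)) (n + 1 / 2) := by
  have h21 : Ici (2 : ℝ) ⊆ Ioi 1 := fun v (hv : 2 ≤ v) => show 1 < v by linarith
  have hα' := smooth_baseF hr (smoothOffCone_of_D hα)
  cases n with
  | zero =>
    refine ((DecayBound.const _ 0).congr (fun _ _ _ _ _ => ?_)).mono (by norm_num)
    simp
  | succ m =>
    have hk : leadCoeff (m + 1) A (m + 1) = -2 * leadCoeff (m + 1) A m := by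
      rw [leadCoeff]
      push_cast
      field_simp
      ring
    have key : DecayBound (Ici 2) (fun u v => AN M r (baseF r α 2) m u v
        - leadCoeff (m + 1) A (m + 1) * ((2 - u) ^ (m + 2) / 2 - (2 - u) ^ (m + 3) * (v - u)⁻¹))
        (m + 3 / 2) := by
      refine DecayBound.of_deriv_v (g' := fun u v =>
        weight M r u v * AN M r (baseF r α 2) (m + 1) u v
          - (v - u)⁻¹ ^ 2 * (leadCoeff (m + 1) A (m + 1) * (2 - u) ^ (m + 3))) (by positivity)
        (fun u v hu hv => ?_) ?_ ?_
      · refine ((hasDerivAt_AN_v hr hM hM' hα' m hu (h21 hv)).sub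
          ((((hasDerivAt_inv_sub_right (by linarith : v - u ≠ 0)).const_mul
            ((2 - u) ^ (m + 3))).const_sub _).const_mul _)).congr_deriv ?_
        ring
      · have hw := decay_weight_pow_sub_inv hr hM hM' (Ici 2) 1
        simp only [pow_one, mul_one] at hw
        have h1 := (decay_AN hr hM hM' hdata (le_refl (m + 1))).subset h21
        have h2 := decay_AN_sub hr hM hM' hα hT hdata
        exact hw.mul_sub_mul h1 (DecayBound.inv_pow_sub _ _) h2 (by push_cast; linarith)
          (by push_cast; linarith)
      · refine (decay_AN_sub_two hr hM hM' hα hT hdata (by omega : m ≤ m + 1)).congr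
          fun u v hu _ hv => ?_
        obtain rfl : v = 2 := hv
        have h : (2 - u) ^ (m + 3) * (2 - u)⁻¹ = (2 - u) ^ (m + 2) := by
          rw [pow_succ, mul_assoc, mul_inv_cancel₀ (by linarith), mul_one]
        rw [h, hk]
        ring
    refine ((key.const_mul (2 * (m + 1 : ℕ) * ((m + 1 : ℕ) + 2) * ((m + 1 : ℕ) + 4))).congr
      fun _ _ _ _ _ => ?_).mono (by push_cast; linarith)
    simp only [Nat.add_sub_cancel]
    ring

lemma decay_weight_mul_AN_succ_sub :
    DecayBound (Ioi 2) (fun u v => weight M r u v ^ (n + 3) * AN M r (baseF r α 2) (n + 1) u v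
      - leadCoeff n A n * M *
        leadProfile n (6 * n ^ 2 + 30 * n + 30) (2 * n * (n + 2) * (n + 4)) u v)
      (-(n + 9 / 2)) := by
  have h21 : Ioi (2 : ℝ) ⊆ Ioi 1 := Ioi_subset_Ioi one_le_two
  have hα' := smoothOffCone_of_D hα
  refine DecayBound.of_deriv_u (g' := fun u v =>
      -((6 * n ^ 2 + 30 * n + 30) * M *
        (weight M r u v ^ (n + 3) * (r u v)⁻¹ * AN M r (baseF r α 2) n u v
          - (v - u)⁻¹ ^ (2 * n + 7) * (leadCoeff n A n * (2 - u) ^ (n + 2))))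
      + M * (weight M r u v ^ (n + 3) *
          (2 * n * (n + 2) * (n + 4) * AN M r (baseF r α 2) (n - 1) u v)
        - (v - u)⁻¹ ^ (2 * n + 6) * (2 * n * (n + 2) * (n + 4) * leadCoeff n A n *
          ((2 - u) ^ (n + 1) / 2 - (2 - u) ^ (n + 2) * (v - u)⁻¹))))
    (by positivity) (fun v hv hS => ?_) (fun u v hu hv hS => ?_) (fun v hv hS => ?_) ?_
  · refine ((smooth_weight_pow_mul_AN hr hM hM' hα' _ _).continuousOn_u (h21 hS)).sub
      (continuousOn_const.mul fun u hu => ?_)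
    exact (hasDerivAt_leadProfile n _ _ hu hS).continuousAt.continuousWithinAt
  · refine ((hasDerivAt_weight_pow_mul_AN hr hM hM' hα' hT n hu (h21 hS)).sub
      ((hasDerivAt_leadProfile n _ _ hu.le hS).const_mul _)).congr_deriv ?_
    push_cast
    ring
  · have hV : v - 2 ≠ 0 := sub_ne_zero.2 (ne_of_gt hS)
    have hy : Tendsto (fun u : ℝ => (v - u)⁻¹ ^ 1) atBot (nhds 0) :=
      (DecayBound.inv_pow_sub univ 1).tendsto_atBot (by norm_num) hv (mem_univ v)
    have h1 : Tendsto (fun u => betaTail n ((2 - u) * (v - u)⁻¹)) atBot (nhds 0) := by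
      have h2 : Tendsto (fun u => 1 - (v - 2) * (v - u)⁻¹ ^ 1) atBot (nhds (1 - (v - 2) * 0)) :=
        (hy.const_mul (v - 2)).const_sub 1
      have h3 : betaTail n (1 - (v - 2) * 0) = 0 := by simp [betaTail]
      refine h3 ▸ (((continuous_betaTail n).tendsto _).comp h2).congr' ?_
      filter_upwards [eventually_le_atBot (-1 : ℝ)] with u hu
      have h4 : v - u ≠ 0 := by linarith
      simp only [Function.comp]
      congr 1
      field_simp
      ring
    have h2 : Tendsto (fun u => (2 - u) ^ (n + 2) * (v - u)⁻¹ ^ (2 * n + 6)) atBot (nhds 0) :=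
      (((DecayBound.two_sub univ).pow (n + 2)).mul
        (DecayBound.inv_pow_sub univ (2 * n + 6))).tendsto_atBot
          (by push_cast; linarith [(n.cast_nonneg : (0 : ℝ) ≤ n)]) hv (mem_univ v)
    have h3 := (((h1.mul_const ((v - 2)⁻¹ ^ (n + 4))).const_mul
      (-(6 * n ^ 2 + 30 * n + 30) + 2 * n * (n + 2) * (n + 4) / (n + 2) : ℝ)).sub (h2.const_mul
        (2 * n * (n + 2) * (n + 4) / (2 * (n + 2)) : ℝ))).const_mul (leadCoeff n A n * M)
    simpa [leadProfile] using (tendsto_weight_pow_mul_AN hr hM hM' hα'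
      (tendsto_iteratedDeriv hr hM hM' hdata) (n + 1) (h21 hS)).sub h3
  · have hw := decay_weight_pow_sub_inv hr hM hM' (Ioi 2) (n + 3)
    have hy1 := DecayBound.inv_pow_sub (Ioi 2) 1
    have hwx : DecayBound (Ioi 2) (fun u v => weight M r u v ^ (n + 3) * (r u v)⁻¹
        - (v - u)⁻¹ ^ (2 * n + 7)) (-(2 * n + 7) - 1 / 2) :=
      (hw.mul_sub_mul (hr.decay_inv hM hM' _) (DecayBound.inv_pow_sub _ _)
        (hr.decay_inv_sub hM hM' _) (by push_cast; linarith) (by push_cast; linarith)).congr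
        fun _ _ _ _ _ => by ring
    have hA := (decay_AN hr hM hM' hdata (le_refl n)).subset h21
    have hA' := (decay_AN_sub hr hM hM' hα hT hdata).subset Ioi_subset_Ici_self
    have hB := (decay_AN_pred_sub hr hM hM' hα hT hdata).subset Ioi_subset_Ici_self
    have hB' : DecayBound (Ioi 2) (fun u v => 2 * n * (n + 2) * (n + 4)
        * AN M r (baseF r α 2) (n - 1) u v) (n + 1) := by
      refine (((decay_mul_AN_pred hr hM hM' hdata (le_refl n)).subset h21).const_mul M⁻¹).congr
        fun _ _ _ _ _ => ?_
      field_simp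
    have h1 := hwx.mul_sub_mul hA (DecayBound.inv_pow_sub _ _) hA' (s := -(n + 9 / 2) - 1)
      (by linarith) (by push_cast; linarith)
    have h2 := hw.mul_sub_mul hB' (DecayBound.inv_pow_sub _ _) hB (s := -(n + 9 / 2) - 1)
      (by push_cast; linarith) (by push_cast; linarith)
    exact (h1.const_mul _).neg.add (h2.const_mul M)

end Interior

section Asymptotics

variable {M : ℝ} {r α : ℝ → ℝ → ℝ} {n : ℕ} {A B C ε C₀ C₁ : ℝ}
  (hr : IsSchwR M r) (hM : 0 < M) (hM' : M ≤ 1 / 8)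
  (hα : ContDiffOn ℝ (⊤ : ℕ∞) (fun p : ℝ × ℝ => α p.1 p.2) D)
  (hT : TeukEq M r α 2 (n + 2)) (hdata : PlusData M r α (n + 2) A B C ε C₀ C₁)

lemma DecayBound.right (S : Set ℝ) : DecayBound S (fun _ v => v) 1 :=
  DecayBound.of_pos (fun u v hu hv _ => by
    rw [Real.rpow_one, abs_of_nonneg (by linarith), abs_of_nonneg (by linarith)]
    linarith) (DecayBound.rpow S 1)

lemma tendsto_mul_inv_sub (u : ℝ) : Tendsto (fun v : ℝ => v * (v - u)⁻¹) atTop (nhds 1) := by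
  have hy : Tendsto (fun v : ℝ => (v - u)⁻¹) atTop (nhds 0) :=
    (tendsto_atTop_add_const_right atTop (-u) tendsto_id).inv_tendsto_atTop
  have h := (hy.const_mul u).const_add 1
  rw [mul_zero, add_zero] at h
  refine h.congr' ?_
  filter_upwards [eventually_gt_atTop u] with v hv
  have : v - u ≠ 0 := sub_ne_zero.2 (ne_of_gt hv)
  field_simp
  ring

include hr hM hM'

lemma tendsto_weight_mul_sq {u : ℝ} (hu : u ≤ -1) :
    Tendsto (fun v => weight M r u v * v ^ 2) atTop (nhds 1) := by
  have hw := decay_weight_pow_sub_inv hr hM hM' univ 1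
  have h1 := (hw.mul ((DecayBound.right univ).pow 2)).tendsto_atTop (by norm_num) hu univ_mem
  have h2 := h1.add ((tendsto_mul_inv_sub u).pow 2)
  rw [one_pow, zero_add] at h2
  refine h2.congr fun v => ?_
  ring

lemma tendsto_mul_inv_r {u : ℝ} (hu : u ≤ -1) :
    Tendsto (fun v => v * (r u v)⁻¹) atTop (nhds 1) := by
  have h1 := ((DecayBound.right univ).mul (hr.decay_inv_sub hM hM' univ)).tendsto_atTop
    (by norm_num) hu univ_mem
  have h2 := h1.add (tendsto_mul_inv_sub u)
  rw [zero_add] at h2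
  refine h2.congr fun v => ?_
  ring

lemma tendsto_r_atTop {u : ℝ} (hu : u ≤ -1) : Tendsto (fun v => r u v) atTop atTop := by
  have h1 : Tendsto (fun v : ℝ => v / 2) atTop atTop := tendsto_id.atTop_div_const two_pos
  refine tendsto_atTop_mono' _ ?_ h1
  filter_upwards [eventually_ge_atTop (1 : ℝ)] with v hv
  have := hr.sub_le hM hM' hu hv
  linarith

lemma tendsto_baseF_div (hf : SmoothOffCone (baseF r α 2)) {u : ℝ} (hu : u ≤ -1) {L : ℝ} (N : ℕ)
    (h : Tendsto (fun v => AN M r (baseF r α 2) N u v / v ^ (N + 1)) atTop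
      (nhds (L * N.factorial))) :
    Tendsto (fun v => baseF r α 2 u v / v) atTop (nhds L) := by
  induction N with
  | zero => simpa [AN] using h
  | succ N ih =>
    refine ih ?_
    have h1 := tendsto_div_pow_of_deriv (a := 2) N
      (fun v hv => hasDerivAt_AN_v hr hM hM' hf N hu (by linarith))
      (K := L * (N + 1).factorial) ?_
    · convert h1 using 2
      rw [Nat.factorial_succ]
      push_cast
      field_simp
    · have h2 := (tendsto_weight_mul_sq hr hM hM' hu).mul h
      rw [one_mul] at h2
      refine h2.congr' ?_
      filter_upwards [eventually_gt_atTop 0] with v hv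
      field_simp
      ring

include hα hT hdata

lemma tendsto_AN_succ_div {u : ℝ} (hu : u ≤ -1) :
    Tendsto (fun v => AN M r (baseF r α 2) (n + 1) u v / v ^ (n + 2)) atTop
      (nhds (leadCoeff n A n * M * ((-(6 * n ^ 2 + 30 * n + 30)
        + 2 * n * (n + 2) * (n + 4) / (n + 2)) * betaTail n 0))) := by
  have hy : Tendsto (fun v : ℝ => (v - u)⁻¹) atTop (nhds 0) :=
    (tendsto_atTop_add_const_right atTop (-u) tendsto_id).inv_tendsto_atTop
  have hV := tendsto_mul_inv_sub 2
  have hQ := ((continuous_betaTail n).tendsto _).comp (hy.const_mul (2 - u))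
  rw [mul_zero] at hQ
  have hP : Tendsto (fun v : ℝ => v ^ (n + 4) * (v - u)⁻¹ ^ (2 * n + 6)) atTop (nhds 0) :=
    (((DecayBound.right univ).pow (n + 4)).mul
      (DecayBound.inv_pow_sub univ (2 * n + 6))).tendsto_atTop
        (by push_cast; linarith [(n.cast_nonneg : (0 : ℝ) ≤ n)]) hu univ_mem
  have hH : Tendsto (fun v => v ^ (n + 4) * leadProfile n (6 * n ^ 2 + 30 * n + 30)
      (2 * n * (n + 2) * (n + 4)) u v) atTop (nhds ((-(6 * n ^ 2 + 30 * n + 30)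
        + 2 * n * (n + 2) * (n + 4) / (n + 2)) * betaTail n 0)) := by
    have h := ((hQ.mul (hV.pow (n + 4))).const_mul
      (-(6 * n ^ 2 + 30 * n + 30) + 2 * n * (n + 2) * (n + 4) / (n + 2) : ℝ)).sub
      (hP.const_mul (2 * n * (n + 2) * (n + 4) / (2 * (n + 2)) * (2 - u) ^ (n + 2) : ℝ))
    rw [one_pow, mul_one, mul_zero, sub_zero] at h
    refine h.congr fun v => ?_
    simp only [leadProfile, Function.comp, mul_pow]
    ring
  have hg := (((DecayBound.right (Ioi 2)).pow (n + 4)).mul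
    (decay_weight_mul_AN_succ_sub hr hM hM' hα hT hdata)).tendsto_atTop
      (by push_cast; linarith) hu (Ioi_mem_atTop 2)
  have h := (hg.add (hH.const_mul (leadCoeff n A n * M))).div
    ((tendsto_weight_mul_sq hr hM hM' hu).pow (n + 3)) (by simp)
  rw [zero_add, one_pow, div_one] at h
  refine h.congr' ?_
  filter_upwards [eventually_ge_atTop (1 : ℝ)] with v hv
  have h1 := (hr.weight_pos hM hM' hu hv).ne'
  have h2 : v ≠ 0 := by linarith
  rw [Pi.div_apply, mul_pow, ← pow_mul, show 2 * (n + 3) = (n + 4) + (n + 2) by ring, pow_add]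
  field_simp
  ring

end Asymptotics

lemma leadCoeff_mul_factorial {n N : ℕ} (A : ℝ) (hN : N ≤ n) :
    leadCoeff n A N * ((n - N).factorial * (n + 4).factorial * (N + 2).factorial)
      = 2 * A * (-1) ^ N * (n.factorial * (n + 4 + N).factorial) := by
  induction N with
  | zero =>
    simp [leadCoeff]
    ring
  | succ N ih =>
    obtain ⟨j, rfl⟩ := Nat.exists_eq_add_of_le hN
    have ih := ih (by omega)
    rw [show N + 1 + j - N = j + 1 by omega, Nat.factorial_succ j] at ih
    rw [leadCoeff, show N + 1 + j - (N + 1) = j by omega, show N + 1 + 2 = N + 2 + 1 by ring,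
      Nat.factorial_succ (N + 2), show N + 1 + j + 4 + (N + 1) = N + 1 + j + 4 + N + 1 by ring,
      Nat.factorial_succ (N + 1 + j + 4 + N)]
    push_cast at ih ⊢
    have h : (N : ℝ) + 3 ≠ 0 := by positivity
    field_simp
    linear_combination (-(N + j + N + 6 : ℝ) * (N + 3)) * ih

lemma leadCoeff_mul_betaTail (n : ℕ) (M A : ℝ) :
    leadCoeff n A n * M * ((-(6 * n ^ 2 + 30 * n + 30)
        + 2 * n * (n + 2) * (n + 4) / (n + 2)) * betaTail n 0)
      = 2 * M * (-1) ^ (n + 3) / ((n + 1) * (n + 4)) * A * (n + 1).factorial := by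
  have h := leadCoeff_mul_factorial A (le_refl n)
  have h1 : (2 * n + 6).factorial = (2 * n + 6) * ((2 * n + 5) * (2 * n + 4).factorial) := by
    rw [← Nat.factorial_succ, ← Nat.factorial_succ]
  have h2 : (n + 4).factorial = (n + 4) * (n + 3).factorial := Nat.factorial_succ _
  rw [show n + 4 + n = 2 * n + 4 by ring, Nat.sub_self, Nat.factorial_zero, h2] at h
  rw [betaTail_zero, h1, Nat.factorial_succ n]
  push_cast at h ⊢
  have h3 : ((2 * n + 4).factorial : ℝ) ≠ 0 := by positivity
  field_simp
  linear_combination (-2 * M * (n + 3) * (2 * n + 5)) * h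

/-- For a smooth solution of `T_{+2,ℓ}` with the `s = +2` scattering data and a priori
bounds, along every outgoing null line `r⁴·α` tends to `(2M(-1)^{ℓ+1}/((ℓ-1)(ℓ+2)))·𝒜`;
in particular if `M𝒜 ≠ 0` then `sup_{v ≥ 1} r⁵|α| = ∞`, i.e. the peeling rate
`Ψ₀ = O(r⁻⁵)` fails towards future null infinity. -/
theorem psi0_fails_peeling (M : ℝ) (hM : 0 < M) (hM' : M ≤ 1 / 8)
    (r α : ℝ → ℝ → ℝ) (hr : IsSchwR M r) (ℓ : ℕ) (hℓ : 2 ≤ ℓ)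
    (hα : ContDiffOn ℝ (⊤ : ℕ∞) (fun p : ℝ × ℝ => α p.1 p.2) D)
    (hT : TeukEq M r α 2 ℓ)
    (A B C ε C₀ C₁ : ℝ) (hdata : PlusData M r α ℓ A B C ε C₀ C₁) :
    (∀ u : ℝ, u ≤ -1 →
      Tendsto (fun v => (r u v) ^ 4 * α u v) atTop
        (nhds (2 * M * (-1 : ℝ) ^ (ℓ + 1) / (((ℓ : ℝ) - 1) * ((ℓ : ℝ) + 2)) * A))) ∧
    (M * A ≠ 0 → ∀ u : ℝ, u ≤ -1 → ∀ K : ℝ, ∃ v : ℝ, 1 ≤ v ∧ K < (r u v) ^ 5 * |α u v|) := by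
  obtain ⟨n, rfl⟩ := Nat.exists_eq_add_of_le' hℓ
  have hf := smooth_baseF hr (smoothOffCone_of_D hα)
  have hlim : ∀ u : ℝ, u ≤ -1 →
      Tendsto (fun v => (r u v) ^ 4 * α u v) atTop
        (nhds (2 * M * (-1 : ℝ) ^ (n + 2 + 1) /
          ((((n + 2 : ℕ) : ℝ) - 1) * (((n + 2 : ℕ) : ℝ) + 2)) * A)) := by
    intro u hu
    have h1 := tendsto_AN_succ_div hr hM hM' hα hT hdata hu
    rw [leadCoeff_mul_betaTail] at h1
    have h2 := (tendsto_baseF_div hr hM hM' hf hu (n + 1) h1).mul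
      (tendsto_mul_inv_r hr hM hM' hu)
    rw [mul_one] at h2
    have h3 : 2 * M * (-1 : ℝ) ^ (n + 2 + 1) /
        ((((n + 2 : ℕ) : ℝ) - 1) * (((n + 2 : ℕ) : ℝ) + 2)) * A
        = 2 * M * (-1) ^ (n + 3) / ((n + 1) * (n + 4)) * A := by
      push_cast
      ring
    rw [h3]
    refine h2.congr' ?_
    filter_upwards [eventually_ge_atTop (1 : ℝ)] with v hv
    have h4 := hr.one_le hM hM' hu hv
    rw [baseF_two]
    field_simp
  refine ⟨hlim, fun hMA u hu K => ?_⟩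
  have hL : 2 * M * (-1 : ℝ) ^ (n + 2 + 1) /
      ((((n + 2 : ℕ) : ℝ) - 1) * (((n + 2 : ℕ) : ℝ) + 2)) * A ≠ 0 := by
    have h1 : ((n + 2 : ℕ) : ℝ) - 1 ≠ 0 := by
      push_cast
      linarith [(n.cast_nonneg : (0 : ℝ) ≤ n)]
    have h2 : ((n + 2 : ℕ) : ℝ) + 2 ≠ 0 := by positivity
    have h3 := right_ne_zero_of_mul hMA
    have h4 := hM.ne'
    positivity
  obtain ⟨v, hv, hKv⟩ := ((eventually_ge_atTop (1 : ℝ)).and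
    (((tendsto_r_atTop hr hM hM' hu).atTop_mul_pos (abs_pos.2 hL)
      (hlim u hu).abs).eventually_gt_atTop K)).exists
  refine ⟨v, hv, hKv.trans_eq ?_⟩
  have h1 := hr.one_le hM hM' hu hv
  rw [abs_mul, abs_of_nonneg (by positivity)]
  ring
end
end

section
/- Fix 0 < M ≤ 1/8 and let α : D → ℝ be a smooth solution of the ℓ = 2, s = +2 mode Teukolsky equation ∂_u(r⁻⁴·Ω⁴·∂_v(r⁵·α)) = −(30M·Ω⁶/r⁷)·r⁵·α on D. Assume: (i) there are constants 𝒜 ∈ ℝ and C₀ > 0 with |α(u,1) − 𝒜·r₀(u)⁻³| ≤ C₀·r₀(u)⁻⁴·log(2+r₀(u)) for all u ≤ −1; (ii) sup_D r³·|α| < ∞; (iii) for every v ≥ 1, (r⁻⁴·Ω⁴·∂_v(r⁵·α))(u,v) → 0 as u → −∞. Then for every fixed u ≤ −1: lim_{v→∞} ∂_v(r⁵·α)(u,v) = −M·𝒜/2, and consequently lim_{v→∞} r(u,v)⁴·α(u,v) = −M·𝒜/2. -/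
noncomputable section
open Real Set Filter

theorem abs_le_of_abs_deriv_le_of_tendsto_atBot {f g f' g' : ℝ → ℝ} {a : ℝ}
    (hfc : ContinuousOn f (Iic a)) (hgc : ContinuousOn g (Iic a))
    (hf : ∀ x < a, HasDerivAt f (f' x) x) (hg : ∀ x < a, HasDerivAt g (g' x) x)
    (hle : ∀ x < a, |f' x| ≤ g' x)
    (hf0 : Tendsto f atBot (nhds 0)) (hg0 : Tendsto g atBot (nhds 0)) :
    ∀ x ≤ a, |f x| ≤ g x := by
  have key : ∀ k k' : ℝ → ℝ, ContinuousOn k (Iic a) → (∀ x < a, HasDerivAt k (k' x) x) →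
      (∀ x < a, 0 ≤ k' x) → Tendsto k atBot (nhds 0) → ∀ x ≤ a, 0 ≤ k x := by
    intro k k' hkc hk hk' hk0 x hx
    have hmono : MonotoneOn k (Iic a) := by
      refine monotoneOn_of_hasDerivWithinAt_nonneg (f' := k') (convex_Iic a) hkc ?_ ?_
      · intro y hy
        rw [interior_Iic] at hy
        exact (hk y hy).hasDerivWithinAt
      · intro y hy
        rw [interior_Iic] at hy
        exact hk' y hy
    refine le_of_tendsto hk0 ?_
    filter_upwards [eventually_le_atBot x] with y hy
    exact hmono (hy.trans hx) hx hy
  intro x hx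
  have h1 := key (fun x => g x - f x) (fun x => g' x - f' x) (hgc.sub hfc)
    (fun x hx => (hg x hx).sub (hf x hx))
    (fun x hx => by linarith [le_abs_self (f' x), hle x hx])
    (by simpa using hg0.sub hf0) x hx
  have h2 := key (fun x => g x + f x) (fun x => g' x + f' x) (hgc.add hfc)
    (fun x hx => (hg x hx).add (hf x hx))
    (fun x hx => by linarith [neg_abs_le (f' x), hle x hx])
    (by simpa using hg0.add hf0) x hx
  exact abs_le.2 ⟨by linarith, by linarith⟩

theorem tendsto_div_self_of_tendsto_deriv {f f' : ℝ → ℝ} {a l : ℝ}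
    (hf : ∀ x > a, HasDerivAt f (f' x) x) (hl : Tendsto f' atTop (nhds l)) :
    Tendsto (fun x => f x / x) atTop (nhds l) := by
  rw [Metric.tendsto_atTop]
  intro ε hε
  obtain ⟨b, hb⟩ := Metric.tendsto_atTop.1 hl (ε / 2) (by positivity)
  set c := max (max b (a + 1)) 1 with hc
  have hcb : b ≤ c := (le_max_left _ _).trans (le_max_left _ _)
  have hca : a < c := by linarith [(le_max_right b (a + 1)).trans (le_max_left _ 1)]
  have hc1 : 1 ≤ c := le_max_right _ _
  refine ⟨max c (2 * |f c - l * c| / ε + 1), fun x hx => ?_⟩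
  have hxc : c ≤ x := (le_max_left _ _).trans hx
  have hx2 : 2 * |f c - l * c| / ε < x := by linarith [(le_max_right _ _).trans hx]
  have hx0 : 0 < x := by linarith
  have hmv : ‖(f x - l * x) - (f c - l * c)‖ ≤ ε / 2 * ‖x - c‖ := by
    refine (convex_Ici c).norm_image_sub_le_of_norm_hasDerivWithin_le
      (f := fun y => f y - l * y) (f' := fun y => f' y - l) ?_ ?_ (mem_Ici.2 le_rfl) hxc
    · intro y hy
      have hy : c ≤ y := hy
      have : HasDerivAt (fun y => f y - l * y) (f' y - l * 1) y :=
        (hf y (by linarith)).sub ((hasDerivAt_id y).const_mul l)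
      rw [mul_one] at this
      exact this.hasDerivWithinAt
    · intro y hy
      have := hb y (hcb.trans hy)
      rw [Real.dist_eq] at this
      exact this.le
  rw [Real.norm_eq_abs, Real.norm_eq_abs, abs_of_nonneg (by linarith : 0 ≤ x - c)] at hmv
  rw [Real.dist_eq, show f x / x - l = (f x - l * x) / x by field_simp, abs_div,
    abs_of_pos hx0, div_lt_iff₀ hx0]
  rw [div_lt_iff₀ hε] at hx2
  have := abs_sub_abs_le_abs_sub (f x - l * x) (f c - l * c)
  nlinarith

theorem uniqueDiffOn_D : UniqueDiffOn ℝ D :=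
  (uniqueDiffOn_Iic (-1 : ℝ)).prod (uniqueDiffOn_Ici (1 : ℝ))

section Slices

variable {f : ℝ × ℝ → ℝ} {u v : ℝ}

theorem hasDerivAt_slice_right (hf : DifferentiableOn ℝ f D) (hu : u ≤ -1) (hv : 1 < v) :
    HasDerivAt (fun v' => f (u, v')) (fderivWithin ℝ f D (u, v) (0, 1)) v := by
  have h1 := (hf (u, v) ⟨hu, hv.le⟩).hasFDerivWithinAt
  have h2 : HasDerivWithinAt (fun v' : ℝ => (u, v')) ((0 : ℝ), (1 : ℝ)) (Ici 1) v :=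
    ((hasDerivAt_const v u).prodMk (hasDerivAt_id v)).hasDerivWithinAt
  have hmaps : MapsTo (fun v' : ℝ => (u, v')) (Ici 1) D := fun v' hv' => ⟨hu, hv'⟩
  exact (h1.comp_hasDerivWithinAt v h2 hmaps).hasDerivAt (Ici_mem_nhds hv)

theorem differentiableAt_slice_left (hf : DifferentiableOn ℝ f D) (hu : u < -1) (hv : 1 ≤ v) :
    DifferentiableAt ℝ (fun u' => f (u', v)) u := by
  have h1 := (hf (u, v) ⟨hu.le, hv⟩).hasFDerivWithinAt
  have h2 : HasDerivWithinAt (fun u' : ℝ => (u', v)) ((1 : ℝ), (0 : ℝ)) (Iic (-1)) u :=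
    ((hasDerivAt_id u).prodMk (hasDerivAt_const u v)).hasDerivWithinAt
  have hmaps : MapsTo (fun u' : ℝ => (u', v)) (Iic (-1)) D := fun u' hu' => ⟨hu', hv⟩
  exact ((h1.comp_hasDerivWithinAt u h2 hmaps).hasDerivAt (Iic_mem_nhds hu)).differentiableAt

theorem continuousOn_slice_right (hf : ContinuousOn f D) (hu : u ≤ -1) :
    ContinuousOn (fun v' => f (u, v')) (Ici 1) :=
  hf.comp (by fun_prop) fun _ hv => ⟨hu, hv⟩

theorem continuousOn_slice_left (hf : ContinuousOn f D) (hv : 1 ≤ v) :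
    ContinuousOn (fun u' => f (u', v)) (Iic (-1)) :=
  hf.comp (by fun_prop) fun _ hu => ⟨hu, hv⟩

theorem contDiffOn_fderivWithin_D (hf : ContDiffOn ℝ (⊤ : ℕ∞) f D) :
    ContDiffOn ℝ (⊤ : ℕ∞) (fun p => fderivWithin ℝ f D p (0, 1)) D :=
  (hf.fderivWithin uniqueDiffOn_D le_rfl).clm_apply contDiffOn_const

end Slices

theorem log_le_two_mul_sqrt {x : ℝ} (hx : 0 < x) : Real.log x ≤ 2 * √x := by
  have h := Real.log_le_sub_one_of_pos (Real.sqrt_pos.2 hx)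
  rw [Real.log_sqrt hx.le] at h
  linarith

namespace IsSchwR

variable {M : ℝ} {r : ℝ → ℝ → ℝ} {u v : ℝ}

theorem sub_le_two_mul (hr : IsSchwR M r) (hM : 0 < M) (h : (u, v) ∈ D) :
    v - u ≤ 2 * r u v - 4 * M := by
  have h1 := hr.gt2M u v h
  have h2 : 0 < r u v / (2 * M) - 1 := by
    rw [sub_pos, lt_div_iff₀ (by positivity)]; linarith
  have h3 := Real.log_le_sub_one_of_pos h2
  have h4 := mul_le_mul_of_nonneg_left h3 (by positivity : 0 ≤ 2 * M)
  have h5 : 2 * M * (r u v / (2 * M) - 1 - 1) = r u v - 4 * M := by field_simp; ring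
  linarith [hr.eqn u v h]

theorem one_add_le (hr : IsSchwR M r) (hM : 0 < M) (h : (u, v) ∈ D) :
    1 + 2 * M ≤ r u v := by
  linarith [hr.sub_le_two_mul hM h, h.1, h.2]

theorem three_quarters_le (hr : IsSchwR M r) (hM : 0 < M) (hM' : M ≤ 1 / 8)
    (h : (u, v) ∈ D) : 3 / 4 ≤ Om2 M r u v := by
  have h1 := hr.one_add_le hM h
  have : 2 * M / r u v ≤ 1 / 4 := by
    rw [div_le_iff₀ (by linarith)]; linarith
  unfold Om2; linarith

theorem Om2_le_one (hr : IsSchwR M r) (hM : 0 < M) (h : (u, v) ∈ D) : Om2 M r u v ≤ 1 := by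
  have h1 := hr.one_add_le hM h
  have : 0 ≤ 2 * M / r u v := by
    have : 0 < r u v := by linarith
    positivity
  unfold Om2; linarith

theorem hasDerivAt_left (hr : IsSchwR M r) (hM : 0 < M) (hM' : M ≤ 1 / 8) (h : (u, v) ∈ D) :
    HasDerivAt (fun u' => r u' v) (-Om2 M r u v) u := by
  have h1 : deriv (fun u' => r u' v) u = -Om2 M r u v := hr.du u v h
  have h2 := hr.three_quarters_le hM hM' h
  rw [← h1]
  exact (differentiableAt_of_deriv_ne_zero (by rw [h1]; linarith)).hasDerivAt

theorem hasDerivAt_right (hr : IsSchwR M r) (hM : 0 < M) (hM' : M ≤ 1 / 8) (h : (u, v) ∈ D) :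
    HasDerivAt (fun v' => r u v') (Om2 M r u v) v := by
  have h1 : deriv (fun v' => r u v') v = Om2 M r u v := hr.dv u v h
  have h2 := hr.three_quarters_le hM hM' h
  rw [← h1]
  exact (differentiableAt_of_deriv_ne_zero (by rw [h1]; linarith)).hasDerivAt

theorem tendsto_atBot (hr : IsSchwR M r) (hM : 0 < M) (hv : 1 ≤ v) :
    Tendsto (fun u => r u v) atBot atTop := by
  have h : Tendsto (fun u : ℝ => (v + -u) / 2) atBot atTop :=
    (tendsto_atTop_add_const_left _ v tendsto_neg_atBot_atTop).atTop_div_const two_pos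
  refine tendsto_atTop_mono' _ ?_ h
  filter_upwards [eventually_le_atBot (-1)] with u hu
  linarith [hr.sub_le_two_mul hM (show (u, v) ∈ D from ⟨hu, hv⟩)]

theorem tendsto_atTop (hr : IsSchwR M r) (hM : 0 < M) (hu : u ≤ -1) :
    Tendsto (fun v => r u v) atTop atTop := by
  have h : Tendsto (fun v : ℝ => (-u + v) / 2) atTop atTop :=
    (tendsto_atTop_add_const_left _ (-u) tendsto_id).atTop_div_const two_pos
  refine tendsto_atTop_mono' _ ?_ h
  filter_upwards [eventually_ge_atTop 1] with v hv
  linarith [hr.sub_le_two_mul hM (show (u, v) ∈ D from ⟨hu, hv⟩)]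

theorem tendsto_Om2_atTop (hr : IsSchwR M r) (hM : 0 < M) (hu : u ≤ -1) :
    Tendsto (fun v => Om2 M r u v) atTop (nhds 1) := by
  simpa [Om2] using ((hr.tendsto_atTop hM hu).const_div_atTop (2 * M)).const_sub 1

theorem apply_one_le (hr : IsSchwR M r) (hM : 0 < M) (hu : u ≤ -1) (hv : 1 ≤ v) :
    r u 1 ≤ r u v := by
  have h0 : (u, (1 : ℝ)) ∈ D := ⟨hu, le_rfl⟩
  by_contra! hlt
  have h1 := hr.gt2M u v ⟨hu, hv⟩
  have h2 : 0 < r u v / (2 * M) - 1 := by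
    rw [sub_pos, lt_div_iff₀ (by positivity)]; linarith
  have h3 : Real.log (r u v / (2 * M) - 1) ≤ Real.log (r u 1 / (2 * M) - 1) := by
    apply Real.log_le_log h2
    gcongr
  have h4 := mul_le_mul_of_nonneg_left h3 (by positivity : 0 ≤ 2 * M)
  linarith [hr.eqn u v ⟨hu, hv⟩, hr.eqn u 1 h0]

/-- The Minkowskian relation `r₀ = r - (v - 1)` holds up to a logarithm. -/
theorem apply_one_mem_Icc (hr : IsSchwR M r) (hM : 0 < M) (hM' : M ≤ 1 / 8) (hu : u ≤ -1)
    (hv : 1 ≤ v) : r u 1 - (r u v - (v - 1)) ∈ Icc 0 √(r u v) := by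
  have h0 : (u, (1 : ℝ)) ∈ D := ⟨hu, le_rfl⟩
  have h1 := hr.one_add_le hM h0
  have h2 := hr.apply_one_le hM hu hv
  have hb : 0 < r u 1 / (2 * M) - 1 := by
    rw [sub_pos, lt_div_iff₀ (by positivity)]; linarith
  have hab : r u 1 / (2 * M) - 1 ≤ r u v / (2 * M) - 1 := by gcongr
  have ha : 0 < r u v / (2 * M) - 1 := hb.trans_le hab
  have hE : r u 1 - (r u v - (v - 1)) = 2 * M *
      (Real.log (r u v / (2 * M) - 1) - Real.log (r u 1 / (2 * M) - 1)) := by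
    linarith [hr.eqn u v ⟨hu, hv⟩, hr.eqn u 1 h0]
  rw [hE]
  have hlog := Real.log_le_log hb hab
  have hle : Real.log (r u v / (2 * M) - 1) ≤
      Real.log (r u v) + Real.log (r u 1 / (2 * M) - 1) := by
    rw [← Real.log_mul (by linarith) hb.ne']
    apply Real.log_le_log ha
    have hb' : 1 / (2 * M) ≤ r u 1 / (2 * M) - 1 := by
      rw [← sub_nonneg]
      have : r u 1 / (2 * M) - 1 - 1 / (2 * M) = (r u 1 - (1 + 2 * M)) / (2 * M) := by
        field_simp; ring
      rw [this]
      exact div_nonneg (by linarith) (by positivity)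
    have := mul_le_mul_of_nonneg_left hb' (by linarith : 0 ≤ r u v)
    rw [mul_one_div] at this
    linarith
  have hs := log_le_two_mul_sqrt (by linarith : 0 < r u v)
  have hsq := Real.sqrt_nonneg (r u v)
  constructor
  · exact mul_nonneg (by positivity) (by linarith)
  · nlinarith

theorem tendsto_sub_one_div (hr : IsSchwR M r) (hM : 0 < M) (hM' : M ≤ 1 / 8) (hu : u ≤ -1) :
    Tendsto (fun v => (v - 1) / r u v) atTop (nhds 1) := by
  have hlim := hr.tendsto_atTop hM hu
  have hlow : Tendsto (fun v => 1 - r u 1 / r u v) atTop (nhds 1) := by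
    simpa using (hlim.const_div_atTop (r u 1)).const_sub 1
  have hup : Tendsto (fun v => 1 + (√(r u v))⁻¹) atTop (nhds 1) := by
    simpa using ((tendsto_inv_atTop_zero.comp (tendsto_sqrt_atTop.comp hlim)).const_add 1)
  refine tendsto_of_tendsto_of_tendsto_of_le_of_le' hlow hup ?_ ?_
  · filter_upwards [eventually_ge_atTop 1] with v hv
    have h1 := hr.one_add_le hM (show (u, v) ∈ D from ⟨hu, hv⟩)
    have h2 := (hr.apply_one_mem_Icc hM hM' hu hv).1
    rw [one_sub_div (by linarith)]
    exact div_le_div_of_nonneg_right (by linarith) (by linarith)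
  · filter_upwards [eventually_ge_atTop 1] with v hv
    have h1 := hr.one_add_le hM (show (u, v) ∈ D from ⟨hu, hv⟩)
    have h0 := hr.one_add_le hM (show (u, (1 : ℝ)) ∈ D from ⟨hu, le_rfl⟩)
    have h2 := (hr.apply_one_mem_Icc hM hM' hu hv).2
    have hr0 : 0 < r u v := by linarith
    have hs : (√(r u v))⁻¹ = √(r u v) / r u v := by
      rw [Real.sqrt_div_self', one_div]
    rw [hs, one_add_div hr0.ne']
    exact div_le_div_of_nonneg_right (by linarith) hr0.le

theorem tendsto_div_apply (hr : IsSchwR M r) (hM : 0 < M) (hM' : M ≤ 1 / 8) (hu : u ≤ -1) :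
    Tendsto (fun v => v / r u v) atTop (nhds 1) := by
  have h := (hr.tendsto_sub_one_div hM hM' hu).add ((hr.tendsto_atTop hM hu).const_div_atTop 1)
  rw [add_zero] at h
  exact h.congr fun v => by rw [← add_div, sub_add_cancel]

end IsSchwR

namespace IsSchwR

variable {M : ℝ} {r : ℝ → ℝ → ℝ} {u v : ℝ}

/-- Integration of a transport equation from past null infinity. -/
theorem abs_le_of_abs_deriv_le (hr : IsSchwR M r) (hM : 0 < M) (hM' : M ≤ 1 / 8) (hv : 1 ≤ v)
    {f f' : ℝ → ℝ} {c n : ℝ} (hn : 1 < n) (hc : ContinuousOn f (Iic (-1)))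
    (hd : ∀ u < -1, HasDerivAt f (f' u) u)
    (hle : ∀ u < -1, |f' u| ≤ c * (Om2 M r u v * r u v ^ (-n)))
    (h0 : Tendsto f atBot (nhds 0)) :
    ∀ u ≤ -1, |f u| ≤ c / (n - 1) * r u v ^ (1 - n) := by
  have hg : ∀ u ≤ -1, HasDerivAt (fun u => c / (n - 1) * r u v ^ (1 - n))
      (c * (Om2 M r u v * r u v ^ (-n))) u := by
    intro u hu
    have hD : (u, v) ∈ D := ⟨hu, hv⟩
    have h1 := hr.one_add_le hM hD
    have h2 := ((hr.hasDerivAt_left hM hM' hD).rpow_const (p := 1 - n)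
      (Or.inl (by linarith))).const_mul (c / (n - 1))
    refine h2.congr_deriv ?_
    have h3 : n - 1 ≠ 0 := by linarith
    rw [show 1 - n - 1 = -n by ring]
    field_simp
    ring
  refine abs_le_of_abs_deriv_le_of_tendsto_atBot hc
    (fun u hu => (hg u hu).continuousAt.continuousWithinAt) hd (fun u hu => hg u hu.le) hle h0 ?_
  have := ((tendsto_rpow_neg_atTop (by linarith : 0 < n - 1)).comp
    (hr.tendsto_atBot hM hv)).const_mul (c / (n - 1))
  simpa [Function.comp_def] using this

variable {ψ : ℝ × ℝ → ℝ}

theorem continuousOn_transport (hr : IsSchwR M r) (hM : 0 < M) (hM' : M ≤ 1 / 8)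
    (hψ : ContDiffOn ℝ (⊤ : ℕ∞) ψ D) (hv : 1 < v) :
    ContinuousOn (fun u => r u v ^ (-4 : ℤ) * Om2 M r u v ^ 2 *
      deriv (fun v' => ψ (u, v')) v) (Iic (-1)) := by
  have h1 : ContinuousOn (fun u => r u v) (Iic (-1)) := fun u hu =>
    (hr.hasDerivAt_left hM hM' (show (u, v) ∈ D from ⟨hu, hv.le⟩)).continuousAt.continuousWithinAt
  have h2 : ∀ u ∈ Iic (-1 : ℝ), r u v ≠ 0 := fun u hu => by
    linarith [hr.one_add_le hM (show (u, v) ∈ D from ⟨hu, hv.le⟩)]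
  have h3 : ContinuousOn (fun u => deriv (fun v' => ψ (u, v')) v) (Iic (-1)) :=
    (continuousOn_slice_left (contDiffOn_fderivWithin_D hψ).continuousOn hv.le).congr fun u hu =>
      (hasDerivAt_slice_right (hψ.differentiableOn (by simp)) hu hv).deriv
  have h4 : ContinuousOn (fun u => Om2 M r u v) (Iic (-1)) :=
    continuousOn_const.sub (continuousOn_const.div h1 h2)
  exact ((h1.zpow₀ _ fun u hu => Or.inl (h2 u hu)).mul (h4.pow 2)).mul h3

theorem differentiableAt_transport (hr : IsSchwR M r) (hM : 0 < M) (hM' : M ≤ 1 / 8)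
    (hψ : ContDiffOn ℝ (⊤ : ℕ∞) ψ D) (hu : u < -1) (hv : 1 < v) :
    DifferentiableAt ℝ (fun u => r u v ^ (-4 : ℤ) * Om2 M r u v ^ 2 *
      deriv (fun v' => ψ (u, v')) v) u := by
  have hD : (u, v) ∈ D := ⟨hu.le, hv.le⟩
  have h1 := (hr.hasDerivAt_left hM hM' hD).differentiableAt
  have h2 : r u v ≠ 0 := by linarith [hr.one_add_le hM hD]
  have h3 : DifferentiableAt ℝ (fun u => deriv (fun v' => ψ (u, v')) v) u := by
    refine (differentiableAt_slice_left
      ((contDiffOn_fderivWithin_D hψ).differentiableOn (by simp)) hu hv.le).congr_of_eventuallyEq ?_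
    filter_upwards [Iic_mem_nhds hu] with u' hu'
    exact (hasDerivAt_slice_right (hψ.differentiableOn (by simp)) hu' hv).deriv
  have h4 : DifferentiableAt ℝ (fun u => Om2 M r u v) u :=
    (differentiableAt_const _).sub ((differentiableAt_const _).div h1 h2)
  exact ((h1.zpow (Or.inl h2)).mul (h4.pow 2)).mul h3

theorem hasDerivAt_transport (hr : IsSchwR M r) (hM : 0 < M) (hM' : M ≤ 1 / 8)
    (hψ : ContDiffOn ℝ (⊤ : ℕ∞) ψ D)
    (hT : ∀ u v : ℝ, (u, v) ∈ D →
      deriv (fun u => r u v ^ (-4 : ℤ) * Om2 M r u v ^ 2 * deriv (fun v' => ψ (u, v')) v) u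
        = -(30 * M * Om2 M r u v ^ 3 / r u v ^ 7) * ψ (u, v))
    (hu : u < -1) (hv : 1 < v) :
    HasDerivAt (fun u => r u v ^ (-4 : ℤ) * Om2 M r u v ^ 2 * deriv (fun v' => ψ (u, v')) v)
      (-(30 * M * Om2 M r u v ^ 3 / r u v ^ 7) * ψ (u, v)) u := by
  rw [← hT u v ⟨hu.le, hv.le⟩]
  exact (hr.differentiableAt_transport hM hM' hψ hu hv).hasDerivAt

theorem abs_deriv_le (hr : IsSchwR M r) (hM : 0 < M) (hM' : M ≤ 1 / 8)
    (hψ : ContDiffOn ℝ (⊤ : ℕ∞) ψ D)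
    (hT : ∀ u v : ℝ, (u, v) ∈ D →
      deriv (fun u => r u v ^ (-4 : ℤ) * Om2 M r u v ^ 2 * deriv (fun v' => ψ (u, v')) v) u
        = -(30 * M * Om2 M r u v ^ 3 / r u v ^ 7) * ψ (u, v))
    (hnoin : ∀ v : ℝ, 1 ≤ v → Tendsto (fun u => r u v ^ (-4 : ℤ) * Om2 M r u v ^ 2 *
      deriv (fun v' => ψ (u, v')) v) atBot (nhds 0))
    {K : ℝ} (hK : ∀ u v : ℝ, (u, v) ∈ D → |ψ (u, v)| ≤ K * r u v ^ 2)
    (hu : u ≤ -1) (hv : 1 < v) : |deriv (fun v' => ψ (u, v')) v| ≤ 15 * M * K := by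
  have hD : (u, v) ∈ D := ⟨hu, hv.le⟩
  have h1 := hr.one_add_le hM hD
  have hr0 : 0 < r u v := by linarith
  have hK0 : 0 ≤ K := by
    have := (abs_nonneg _).trans (hK u v hD)
    exact nonneg_of_mul_nonneg_left this (by positivity)
  have hO := hr.three_quarters_le hM hM' hD
  have key := hr.abs_le_of_abs_deriv_le hM hM' hv.le (c := 30 * M * K) (n := 5) (by norm_num)
    (hr.continuousOn_transport hM hM' hψ hv)
    (fun u hu => hr.hasDerivAt_transport hM hM' hψ hT hu hv) ?_ (hnoin v hv.le) u hu
  · have e : r u v ^ (1 - 5 : ℝ) = (r u v ^ 4)⁻¹ := by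
      rw [show (1 - 5 : ℝ) = -((4 : ℕ) : ℝ) by norm_num, Real.rpow_neg hr0.le, Real.rpow_natCast]
    rw [e, zpow_neg, abs_mul, abs_mul, abs_of_pos (by positivity), abs_of_nonneg (by positivity)]
      at key
    have h4 : (r u v ^ (4 : ℤ))⁻¹ = (r u v ^ 4)⁻¹ := by norm_cast
    rw [h4, mul_assoc, mul_comm _ (r u v ^ 4)⁻¹] at key
    have key := le_of_mul_le_mul_left key (by positivity)
    have h5 : (9 / 16 : ℝ) ≤ Om2 M r u v ^ 2 := by nlinarith
    have h6 := mul_le_mul_of_nonneg_right h5 (abs_nonneg (deriv (fun v' => ψ (u, v')) v))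
    have : 0 ≤ M * K := by positivity
    linarith
  · intro u hu
    have hD : (u, v) ∈ D := ⟨hu.le, hv.le⟩
    have h1 := hr.one_add_le hM hD
    have hr0 : 0 < r u v := by linarith
    have hO := hr.three_quarters_le hM hM' hD
    have hO' := hr.Om2_le_one hM hD
    have hO0 : 0 < Om2 M r u v := by linarith
    have e : r u v ^ (-5 : ℝ) = (r u v ^ 5)⁻¹ := by
      rw [show (-5 : ℝ) = -((5 : ℕ) : ℝ) by norm_num, Real.rpow_neg hr0.le, Real.rpow_natCast]
    rw [e, abs_mul, abs_neg, abs_of_nonneg (by positivity)]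
    calc 30 * M * Om2 M r u v ^ 3 / r u v ^ 7 * |ψ (u, v)|
        ≤ 30 * M * Om2 M r u v ^ 1 / r u v ^ 7 * (K * r u v ^ 2) := by
          gcongr 30 * M * ?_ / _ * ?_
          · exact pow_le_pow_of_le_one hO0.le hO' (by norm_num)
          · exact hK u v hD
      _ = _ := by field_simp

theorem abs_sub_le_of_data (hr : IsSchwR M r) (hM : 0 < M) (hM' : M ≤ 1 / 8)
    (hψ : ContDiffOn ℝ (⊤ : ℕ∞) ψ D) {A C₀ B : ℝ} (hC₀ : 0 < C₀) (hB : 0 ≤ B)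
    (hdata : ∀ u : ℝ, u ≤ -1 →
      |ψ (u, 1) - A * r u 1 ^ 2| ≤ C₀ * r u 1 * Real.log (2 + r u 1))
    (hdv : ∀ u v : ℝ, u ≤ -1 → 1 < v → |deriv (fun v' => ψ (u, v')) v| ≤ B)
    (hu : u ≤ -1) (hv : 1 ≤ v) :
    |ψ (u, v) - A * (r u v - (v - 1)) ^ 2|
      ≤ (2 * |A| + 4 * C₀ + 2 * B) * (r u v * √(r u v)) := by
  have hD : (u, v) ∈ D := ⟨hu, hv⟩
  have h0 := hr.one_add_le hM (show (u, (1 : ℝ)) ∈ D from ⟨hu, le_rfl⟩)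
  have h1 := hr.apply_one_le hM hu hv
  obtain ⟨h2, h3⟩ := hr.apply_one_mem_Icc hM hM' hu hv
  have h4 := hr.sub_le_two_mul hM hD
  have hr0 : 0 ≤ r u v := by linarith
  have hs1 : 1 ≤ √(r u v) := Real.one_le_sqrt.2 (by linarith)
  have hsr : √(r u v) ≤ r u v := Real.sqrt_le_self_iff.2 (Or.inr (by linarith))
  have hd : |ψ (u, v) - ψ (u, 1)| ≤ B * (v - 1) := by
    rcases hv.eq_or_lt with rfl | hv
    · simp
    obtain ⟨c, hc, hslope⟩ := exists_deriv_eq_slope (fun v' => ψ (u, v')) hv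
      ((continuousOn_slice_right hψ.continuousOn hu).mono Icc_subset_Ici_self)
      fun c hc => (hasDerivAt_slice_right (hψ.differentiableOn (by simp)) hu
        hc.1).differentiableAt.differentiableWithinAt
    have := hdv u c hu hc.1
    rwa [hslope, abs_div, abs_of_pos (sub_pos.2 hv), div_le_iff₀ (sub_pos.2 hv)] at this
  have hlog : Real.log (2 + r u 1) ≤ 4 * √(r u v) := by
    have h5 := log_le_two_mul_sqrt (by linarith : 0 < 2 + r u 1)
    have h6 : √(2 + r u 1) ≤ √(2 ^ 2 * r u v) := Real.sqrt_le_sqrt (by linarith)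
    rw [Real.sqrt_mul (by norm_num), Real.sqrt_sq (by norm_num)] at h6
    linarith
  have hA : |A * r u 1 ^ 2 - A * (r u v - (v - 1)) ^ 2| ≤ 2 * |A| * (r u v * √(r u v)) := by
    have e : A * r u 1 ^ 2 - A * (r u v - (v - 1)) ^ 2 =
      A * ((r u 1 + (r u v - (v - 1))) * (r u 1 - (r u v - (v - 1)))) := by ring
    have h5 : |r u 1 + (r u v - (v - 1))| ≤ 2 * r u v := abs_le.2 ⟨by linarith, by linarith⟩
    have h6 : |r u 1 - (r u v - (v - 1))| ≤ √(r u v) := abs_le.2 ⟨by linarith, h3⟩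
    rw [e, abs_mul, abs_mul]
    calc _ ≤ |A| * (2 * r u v * √(r u v)) := by gcongr
      _ = _ := by ring
  have hC : |ψ (u, 1) - A * r u 1 ^ 2| ≤ 4 * C₀ * (r u v * √(r u v)) := by
    refine (hdata u hu).trans ?_
    calc _ ≤ C₀ * r u v * (4 * √(r u v)) := by
          gcongr
          exact Real.log_nonneg (by linarith)
      _ = _ := by ring
  have hBr : B * (v - 1) ≤ 2 * B * (r u v * √(r u v)) := by
    have : v - 1 ≤ 2 * (r u v * √(r u v)) := by nlinarith
    nlinarith
  have e : ψ (u, v) - A * (r u v - (v - 1)) ^ 2 = (ψ (u, v) - ψ (u, 1)) +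
    (ψ (u, 1) - A * r u 1 ^ 2) + (A * r u 1 ^ 2 - A * (r u v - (v - 1)) ^ 2) := by ring
  rw [e]
  refine (abs_add_three _ _ _).trans ?_
  linarith

theorem abs_transport_sub_le (hr : IsSchwR M r) (hM : 0 < M) (hM' : M ≤ 1 / 8)
    (hψ : ContDiffOn ℝ (⊤ : ℕ∞) ψ D)
    (hT : ∀ u v : ℝ, (u, v) ∈ D →
      deriv (fun u => r u v ^ (-4 : ℤ) * Om2 M r u v ^ 2 * deriv (fun v' => ψ (u, v')) v) u
        = -(30 * M * Om2 M r u v ^ 3 / r u v ^ 7) * ψ (u, v))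
    (hnoin : ∀ v : ℝ, 1 ≤ v → Tendsto (fun u => r u v ^ (-4 : ℤ) * Om2 M r u v ^ 2 *
      deriv (fun v' => ψ (u, v')) v) atBot (nhds 0))
    {A E : ℝ} (hE : ∀ u v : ℝ, (u, v) ∈ D →
      |ψ (u, v) - A * (r u v - (v - 1)) ^ 2| ≤ E * (r u v * √(r u v)))
    (hu : u ≤ -1) (hv : 1 < v) :
    |r u v ^ (-4 : ℤ) * Om2 M r u v ^ 2 * deriv (fun v' => ψ (u, v')) v -
      30 * M * A * (-(r u v)⁻¹ ^ 4 / 4 + 2 * (v - 1) * (r u v)⁻¹ ^ 5 / 5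
        - (v - 1) ^ 2 * (r u v)⁻¹ ^ 6 / 6)|
      ≤ 30 * M * (E + 2 * |A|) / (11 / 2 - 1) * r u v ^ (1 - 11 / 2 : ℝ) := by
  have hd : ∀ u ≤ -1, HasDerivAt (fun u => 30 * M * A * (-(r u v)⁻¹ ^ 4 / 4 +
      2 * (v - 1) * (r u v)⁻¹ ^ 5 / 5 - (v - 1) ^ 2 * (r u v)⁻¹ ^ 6 / 6))
      (-(30 * M * A * Om2 M r u v * (r u v - (v - 1)) ^ 2 / r u v ^ 7)) u := by
    intro u hu
    have hD : (u, v) ∈ D := ⟨hu, hv.le⟩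
    have hr0 : r u v ≠ 0 := by linarith [hr.one_add_le hM hD]
    have hi : HasDerivAt (fun u => (r u v)⁻¹) (-(-Om2 M r u v) / r u v ^ 2) u :=
      (hr.hasDerivAt_left hM hM' hD).inv hr0
    have := ((((hi.pow 4).neg.div_const 4).add (((hi.pow 5).const_mul (2 * (v - 1))).div_const 5)).sub
      (((hi.pow 6).const_mul ((v - 1) ^ 2)).div_const 6)).const_mul (30 * M * A)
    refine this.congr_deriv ?_
    push_cast
    field_simp
    ring
  have hlim : Tendsto (fun u => 30 * M * A * (-(r u v)⁻¹ ^ 4 / 4 +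
      2 * (v - 1) * (r u v)⁻¹ ^ 5 / 5 - (v - 1) ^ 2 * (r u v)⁻¹ ^ 6 / 6)) atBot (nhds 0) := by
    have hcont : Continuous fun x : ℝ => 30 * M * A * (-x ^ 4 / 4 + 2 * (v - 1) * x ^ 5 / 5
      - (v - 1) ^ 2 * x ^ 6 / 6) := by fun_prop
    have := (hcont.tendsto 0).comp (tendsto_inv_atTop_zero.comp (hr.tendsto_atBot hM hv.le))
    simpa [Function.comp_def] using this
  refine hr.abs_le_of_abs_deriv_le hM hM' hv.le (by norm_num)
    ((hr.continuousOn_transport hM hM' hψ hv).sub fun u hu =>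
      (hd u hu).continuousAt.continuousWithinAt)
    (fun u hu => (hr.hasDerivAt_transport hM hM' hψ hT hu hv).sub (hd u hu.le)) ?_
    (by rw [← sub_zero (0 : ℝ)]; exact (hnoin v hv.le).sub hlim) u hu
  intro u hu
  have hD : (u, v) ∈ D := ⟨hu.le, hv.le⟩
  have h1 := hr.one_add_le hM hD
  have hr0 : 0 < r u v := by linarith
  have hO := hr.three_quarters_le hM hM' hD
  have hO' := hr.Om2_le_one hM hD
  have hO0 : 0 < Om2 M r u v := by linarith
  have h4 := hr.sub_le_two_mul hM hD
  have hs1 : 1 ≤ √(r u v) := Real.one_le_sqrt.2 (by linarith)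
  have e : r u v ^ (-(11 / 2) : ℝ) = r u v * √(r u v) / r u v ^ 7 := by
    rw [show (-(11 / 2) : ℝ) = 1 + 1 / 2 - (7 : ℕ) by norm_num, Real.rpow_sub hr0,
      Real.rpow_add hr0, Real.rpow_one, Real.rpow_natCast, Real.sqrt_eq_rpow]
  have hsub : (r u v - (v - 1)) ^ 2 ≤ r u v ^ 2 := by
    apply sq_le_sq'
    · linarith [hu, hv]
    · linarith
  have hOm : (1 - Om2 M r u v ^ 2) * r u v ≤ 1 := by
    have : Om2 M r u v * r u v = r u v - 2 * M := by unfold Om2; field_simp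
    nlinarith
  have hOm0 : 0 ≤ 1 - Om2 M r u v ^ 2 := by nlinarith
  have hmain : |Om2 M r u v ^ 2 * (ψ (u, v) - A * (r u v - (v - 1)) ^ 2) -
      (1 - Om2 M r u v ^ 2) * (A * (r u v - (v - 1)) ^ 2)| ≤
      (E + 2 * |A|) * (r u v * √(r u v)) := by
    have ha : |Om2 M r u v ^ 2 * (ψ (u, v) - A * (r u v - (v - 1)) ^ 2)| ≤
        E * (r u v * √(r u v)) := by
      rw [abs_mul, abs_of_nonneg (by positivity)]
      exact (mul_le_of_le_one_left (abs_nonneg _) (by linarith)).trans (hE u v hD)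
    have hb : |(1 - Om2 M r u v ^ 2) * (A * (r u v - (v - 1)) ^ 2)| ≤
        2 * |A| * (r u v * √(r u v)) := by
      rw [abs_mul, abs_mul, abs_of_nonneg hOm0, abs_of_nonneg (sq_nonneg (r u v - (v - 1)))]
      calc _ ≤ (1 - Om2 M r u v ^ 2) * (|A| * r u v ^ 2) := by gcongr
        _ = (1 - Om2 M r u v ^ 2) * r u v * (|A| * r u v) := by ring
        _ ≤ 1 * (|A| * r u v) := by gcongr
        _ ≤ 2 * |A| * (r u v * √(r u v)) := by
          have : 0 ≤ |A| * r u v := by positivity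
          nlinarith
    exact (abs_sub _ _).trans (by linarith)
  have e2 : -(30 * M * Om2 M r u v ^ 3 / r u v ^ 7) * ψ (u, v) -
      -(30 * M * A * Om2 M r u v * (r u v - (v - 1)) ^ 2 / r u v ^ 7) =
      -(30 * M * Om2 M r u v / r u v ^ 7) *
        (Om2 M r u v ^ 2 * (ψ (u, v) - A * (r u v - (v - 1)) ^ 2) -
          (1 - Om2 M r u v ^ 2) * (A * (r u v - (v - 1)) ^ 2)) := by
    field_simp
    ring
  rw [e2, e, abs_mul, abs_neg, abs_of_nonneg (by positivity)]
  calc _ ≤ 30 * M * Om2 M r u v / r u v ^ 7 * ((E + 2 * |A|) * (r u v * √(r u v))) := by gcongr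
    _ = _ := by ring

theorem tendsto_deriv_of_transport (hr : IsSchwR M r) (hM : 0 < M) (hM' : M ≤ 1 / 8)
    {A C : ℝ} (hu : u ≤ -1)
    (h : ∀ v : ℝ, 1 < v → |r u v ^ (-4 : ℤ) * Om2 M r u v ^ 2 * deriv (fun v' => ψ (u, v')) v -
      30 * M * A * (-(r u v)⁻¹ ^ 4 / 4 + 2 * (v - 1) * (r u v)⁻¹ ^ 5 / 5
        - (v - 1) ^ 2 * (r u v)⁻¹ ^ 6 / 6)| ≤ C * r u v ^ (1 - 11 / 2 : ℝ)) :
    Tendsto (fun v => deriv (fun v' => ψ (u, v')) v) atTop (nhds (-(M * A) / 2)) := by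
  have hO := (hr.tendsto_Om2_atTop hM hu).pow 2
  have hP : Continuous fun t : ℝ => 30 * M * A * (-1 / 4 + 2 * t / 5 - t ^ 2 / 6) := by fun_prop
  have hQ := (hP.tendsto 1).comp (hr.tendsto_sub_one_div hM hM' hu)
  have hR : Tendsto (fun v => C * r u v ^ (-(1 / 2) : ℝ)) atTop (nhds 0) := by
    simpa [Function.comp_def] using ((tendsto_rpow_neg_atTop (by norm_num : (0 : ℝ) < 1 / 2)).comp
      (hr.tendsto_atTop hM hu)).const_mul C
  have hdiff : Tendsto (fun v => Om2 M r u v ^ 2 * deriv (fun v' => ψ (u, v')) v -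
      30 * M * A * (-1 / 4 + 2 * ((v - 1) / r u v) / 5 - ((v - 1) / r u v) ^ 2 / 6))
      atTop (nhds 0) := by
    refine squeeze_zero_norm' ?_ hR
    filter_upwards [eventually_gt_atTop 1] with v hv
    have h1 := hr.one_add_le hM (show (u, v) ∈ D from ⟨hu, hv.le⟩)
    have hr0 : 0 < r u v := by linarith
    have e1 : Om2 M r u v ^ 2 * deriv (fun v' => ψ (u, v')) v -
        30 * M * A * (-1 / 4 + 2 * ((v - 1) / r u v) / 5 - ((v - 1) / r u v) ^ 2 / 6) =
        r u v ^ 4 * (r u v ^ (-4 : ℤ) * Om2 M r u v ^ 2 * deriv (fun v' => ψ (u, v')) v -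
      30 * M * A * (-(r u v)⁻¹ ^ 4 / 4 + 2 * (v - 1) * (r u v)⁻¹ ^ 5 / 5
        - (v - 1) ^ 2 * (r u v)⁻¹ ^ 6 / 6)) := by
      have h4 : r u v ^ (-4 : ℤ) = (r u v ^ 4)⁻¹ := by rw [zpow_neg]; norm_cast
      rw [h4]
      field_simp
    have e2 : r u v ^ (-(1 / 2) : ℝ) = r u v ^ 4 * r u v ^ (1 - 11 / 2 : ℝ) := by
      rw [← Real.rpow_natCast, ← Real.rpow_add hr0]
      norm_num
    rw [Real.norm_eq_abs, e1, e2, abs_mul, abs_of_nonneg (by positivity), mul_left_comm]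
    gcongr
    exact h v hv
  have hsum := (hdiff.add hQ).div hO (by norm_num)
  have hval : (0 + 30 * M * A * (-1 / 4 + 2 * 1 / 5 - 1 ^ 2 / 6)) / 1 ^ 2 = -(M * A) / 2 := by ring
  rw [hval] at hsum
  refine hsum.congr' ?_
  filter_upwards [eventually_gt_atTop 1] with v hv
  have := hr.three_quarters_le hM hM' (show (u, v) ∈ D from ⟨hu, hv.le⟩)
  have hne : Om2 M r u v ≠ 0 := by linarith
  simp only [Pi.div_apply, Function.comp_apply, sub_add_cancel]
  field_simp

end IsSchwR

/-- For a smooth solution of the `ℓ = 2`, `s = +2` Teukolsky equation with data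
`α ~ 𝒜 r₀⁻³` on the ingoing cone `{v = 1}`, the global bound `r³|α| ≲ 1`, and no incoming
radiation from past null infinity, one has `∂_v(r⁵α) → -M𝒜/2` and hence
`r⁴α → -M𝒜/2` along every outgoing null line. -/
theorem lowest_mode_psi0_asymptotics (M : ℝ) (hM : 0 < M) (hM' : M ≤ 1 / 8)
    (r α : ℝ → ℝ → ℝ) (hr : IsSchwR M r)
    (hα : ContDiffOn ℝ (⊤ : ℕ∞) (fun p : ℝ × ℝ => α p.1 p.2) D)
    (hT : ∀ u v : ℝ, (u, v) ∈ D →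
      deriv (fun u' => (r u' v) ^ (-4 : ℤ) * (Om2 M r u' v) ^ 2 *
          deriv (fun v' => (r u' v') ^ 5 * α u' v') v) u
        = -(30 * M * (Om2 M r u v) ^ 3 / (r u v) ^ 7) * ((r u v) ^ 5 * α u v))
    (A C₀ : ℝ) (hC₀ : 0 < C₀)
    (hdata : ∀ u : ℝ, u ≤ -1 →
      |α u 1 - A * (r u 1) ^ (-3 : ℤ)| ≤ C₀ * (r u 1) ^ (-4 : ℤ) * Real.log (2 + r u 1))
    (hbdd : ∃ K : ℝ, ∀ u v : ℝ, (u, v) ∈ D → (r u v) ^ 3 * |α u v| ≤ K)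
    (hnoin : ∀ v : ℝ, 1 ≤ v →
      Tendsto (fun u => (r u v) ^ (-4 : ℤ) * (Om2 M r u v) ^ 2 *
          deriv (fun v' => (r u v') ^ 5 * α u v') v) atBot (nhds 0)) :
    ∀ u : ℝ, u ≤ -1 →
      Tendsto (fun v => deriv (fun v' => (r u v') ^ 5 * α u v') v) atTop
        (nhds (-(M * A) / 2)) ∧
      Tendsto (fun v => (r u v) ^ 4 * α u v) atTop (nhds (-(M * A) / 2)) := by
  have hψ : ContDiffOn ℝ (⊤ : ℕ∞) (fun p : ℝ × ℝ => r p.1 p.2 ^ 5 * α p.1 p.2) D :=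
    (hr.smooth.pow 5).mul hα
  obtain ⟨K, hK⟩ := hbdd
  have hK' : ∀ u v : ℝ, (u, v) ∈ D → |r u v ^ 5 * α u v| ≤ K * r u v ^ 2 := by
    intro u v hD
    have hr0 : 0 < r u v := by linarith [hr.gt2M u v hD]
    rw [abs_mul, abs_of_pos (by positivity)]
    calc r u v ^ 5 * |α u v| = r u v ^ 3 * |α u v| * r u v ^ 2 := by ring
      _ ≤ _ := by gcongr; exact hK u v hD
  have hK0 : 0 ≤ K := by
    have hD : ((-1 : ℝ), (1 : ℝ)) ∈ D := ⟨le_rfl, le_rfl⟩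
    have hr0 : 0 < r (-1) 1 := by linarith [hr.gt2M _ _ hD]
    exact (by positivity : 0 ≤ r (-1) 1 ^ 3 * |α (-1) 1|).trans (hK _ _ hD)
  have hdata' : ∀ u : ℝ, u ≤ -1 → |r u 1 ^ 5 * α u 1 - A * r u 1 ^ 2| ≤
      C₀ * r u 1 * Real.log (2 + r u 1) := by
    intro u hu
    have hr0 : 0 < r u 1 := by linarith [hr.gt2M u 1 ⟨hu, le_rfl⟩]
    have e3 : r u 1 ^ (-3 : ℤ) = (r u 1 ^ 3)⁻¹ := by rw [zpow_neg]; norm_cast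
    have e4 : r u 1 ^ (-4 : ℤ) = (r u 1 ^ 4)⁻¹ := by rw [zpow_neg]; norm_cast
    have h := mul_le_mul_of_nonneg_left (hdata u hu) (by positivity : 0 ≤ r u 1 ^ 5)
    rw [e3, e4, ← abs_of_nonneg (by positivity : 0 ≤ r u 1 ^ 5), ← abs_mul,
      abs_of_nonneg (by positivity : 0 ≤ r u 1 ^ 5)] at h
    have e1 : r u 1 ^ 5 * (α u 1 - A * (r u 1 ^ 3)⁻¹) = r u 1 ^ 5 * α u 1 - A * r u 1 ^ 2 := by
      field_simp
    have e2 : r u 1 ^ 5 * (C₀ * (r u 1 ^ 4)⁻¹ * Real.log (2 + r u 1)) =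
        C₀ * r u 1 * Real.log (2 + r u 1) := by
      field_simp
    rwa [e1, e2] at h
  have hE := fun u v (hD : (u, v) ∈ D) => hr.abs_sub_le_of_data hM hM' hψ hC₀
    (by positivity : 0 ≤ 15 * M * K) hdata'
    (fun u v hu hv => hr.abs_deriv_le hM hM' hψ hT hnoin hK' hu hv) hD.1 hD.2
  intro u hu
  have hlim := hr.tendsto_deriv_of_transport hM hM' (A := A)
    (ψ := fun p => r p.1 p.2 ^ 5 * α p.1 p.2) hu
    fun v hv => hr.abs_transport_sub_le hM hM' hψ hT hnoin hE hu hv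
  refine ⟨hlim, ?_⟩
  have hdiv := tendsto_div_self_of_tendsto_deriv (f := fun v => r u v ^ 5 * α u v) (a := 1)
    (fun v hv => (hasDerivAt_slice_right (hψ.differentiableOn (by simp)) hu
      hv).differentiableAt.hasDerivAt) hlim
  have hratio := hr.tendsto_div_apply hM hM' hu
  have := hdiv.mul hratio
  rw [mul_one] at this
  refine this.congr' ?_
  filter_upwards [eventually_ge_atTop 1] with v hv
  have hr0 : 0 < r u v := by linarith [hr.gt2M u v ⟨hu, hv⟩]
  field_simp
end
end
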